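/- arXiv:1211.1309 — 4 statements merged into one kernel-verified Lean document; each statement's English description precedes it below -/
import Mathlib

section
/- Let Θ = Θ₀(k,k,r,λ) (k-dimensional PCA with no sparsity constraint), and suppose the observed n×k matrix X has rows i.i.d. N(0,Σ) with Σ ∈ Θ. Then there is an absolute constant c > 0 such that inf_{V̂} sup_{Σ ∈ Θ} E‖V̂V̂' − VV'‖_F² ≥ c·( r ∧ (k−r) ∧ r(k−r)/(n·h(λ)) ), where the infimum is over all estimators V̂ = V̂(X) with values in O(k,r). -/
open MeasureTheory ProbabilityTheory Matrix Real
open scoped BigOperators ENNReal NNReal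

noncomputable section

namespace SparsePCA

/-- The measure on `ι → ℝ` with i.i.d. standard normal coordinates. -/
def stdGaussian (ι : Type*) [Fintype ι] : Measure (ι → ℝ) :=
  Measure.pi fun _ => gaussianReal 0 1

/-- The measure on `Fin n → Fin m → ℝ` whose entries are i.i.d. standard normal. -/
def gaussianMatrix (n m : ℕ) : Measure (Fin n → Fin m → ℝ) :=
  Measure.pi fun _ => stdGaussian (Fin m)

/-- `V` has orthonormal columns, i.e. `V ∈ O(p,r)`. -/
def IsOrthonormalCols {p r : ℕ} (V : Matrix (Fin p) (Fin r) ℝ) : Prop :=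
  Vᵀ * V = 1

/-- Squared Frobenius norm. -/
def frobSq {m k : Type*} [Fintype m] [Fintype k] (A : Matrix m k ℝ) : ℝ :=
  ∑ i, ∑ j, (A i j) ^ 2

/-- Subspace estimation loss `‖V Vᵀ - W Wᵀ‖_F²`. -/
def loss {p r : ℕ} (V W : Matrix (Fin p) (Fin r) ℝ) : ℝ :=
  frobSq (V * Vᵀ - W * Wᵀ)

/-- Euclidean norm of row `j` of `V`. -/
def rowNorm {p r : ℕ} (V : Matrix (Fin p) (Fin r) ℝ) (j : Fin p) : ℝ :=
  Real.sqrt (∑ i, (V j i) ^ 2)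

/-- The `j`-th largest row norm of `V` (zero-based: `j = 0` is the largest). -/
def sortedRowNorm {p r : ℕ} (V : Matrix (Fin p) (Fin r) ℝ) (j : Fin p) : ℝ :=
  rowNorm V ((Tuple.sort (fun i => - rowNorm V i)) j)

/-- Weak `ℓ_q` radius `‖V‖_{q,w} = max_j j ‖V_{(j)*}‖^q`, with the convention
`0 ^ q = 0` (so that for `q = 0` this is the number of nonzero rows). -/
def weakLq {p r : ℕ} (q : ℝ) (V : Matrix (Fin p) (Fin r) ℝ) : ℝ :=
  ⨆ j : Fin p, ((j : ℕ) + 1 : ℝ) *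
    (if sortedRowNorm V j = 0 then 0 else (sortedRowNorm V j) ^ q)

/-- `h(λ) = λ² / (λ + 1)`. -/
def hfun (lam : ℝ) : ℝ := lam ^ 2 / (lam + 1)

/-- The rate function `Ψ(k,p,r,n,λ)`. -/
def Psi (k p r n : ℕ) (lam : ℝ) : ℝ :=
  ((r : ℝ) * k + k * Real.log (Real.exp 1 * p / k)) / (n * hfun lam)

/-- The rate function `Ψ₀(k,p,r,n,λ)`. -/
def Psi0 (k p r n : ℕ) (lam : ℝ) : ℝ :=
  ((r : ℝ) * ((k : ℝ) - r) + k * Real.log (Real.exp 1 * p / k)) / (n * hfun lam)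

/-- `x_q(s,p,r,n,λ)`. -/
def xq (q s : ℝ) (p r n : ℕ) (lam : ℝ) : ℝ :=
  sSup {x : ℝ | 0 ≤ x ∧ x ≤ p ∧
    x ≤ s * (n * hfun lam / ((r : ℝ) + Real.log (Real.exp 1 * p / x))) ^ (q / 2)}

/-- Effective dimension `k*_q = ⌈x_q⌉`. -/
def kq (q s : ℝ) (p r n : ℕ) (lam : ℝ) : ℕ := ⌈xq q s p r n lam⌉₊

/-- Membership of `Σ = V Λ Vᵀ + I` in `Θ_q(s,p,r,λ)` with constant `κ`,
phrased in terms of the pair `(V, Λ)`. -/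
def InTheta (q s : ℝ) (p r : ℕ) (lam κ : ℝ)
    (V : Matrix (Fin p) (Fin r) ℝ) (Λ : Fin r → ℝ) : Prop :=
  IsOrthonormalCols V ∧ weakLq q V ≤ s ∧ Antitone Λ ∧
    (∀ i, 0 < lam ∧ lam ≤ Λ i ∧ Λ i ≤ κ * lam)

/-- The distribution of the data matrix `X = U D Vᵀ + σ Z` (rows i.i.d.
`N(0, V Λ Vᵀ + σ² I_p)`), as a measure on `Fin n → Fin p → ℝ`. -/
def spikedMeasure (n p r : ℕ) (Λ : Fin r → ℝ) (V : Matrix (Fin p) (Fin r) ℝ)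
    (σ2 : ℝ) : Measure (Fin n → Fin p → ℝ) :=
  Measure.map
    (fun w : (Fin n → Fin r → ℝ) × (Fin n → Fin p → ℝ) =>
      fun i j => (∑ k, w.1 i k * Real.sqrt (Λ k) * V j k) + Real.sqrt σ2 * w.2 i j)
    ((gaussianMatrix n r).prod (gaussianMatrix n p))


/-- The minimax risk for estimating the principal subspace over
`Θ_q(s,p,r,λ)` (noise variance `1`). -/
def minimaxRisk (q : ℝ) (n p r : ℕ) (s lam κ : ℝ) : ℝ :=
  ⨅ est : {f : (Fin n → Fin p → ℝ) → (Fin p → Fin r → ℝ) //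
      Measurable f ∧ ∀ x, IsOrthonormalCols (Matrix.of (f x))},
    ⨆ (V : Matrix (Fin p) (Fin r) ℝ) (Λ : Fin r → ℝ)
      (_ : InTheta q s p r lam κ V Λ),
      ∫ x, loss (Matrix.of (est.1 x)) V ∂ spikedMeasure n p r Λ V 1

/-! ### Product densities -/

lemma lintegral_pi_prod {X : Type*} [MeasurableSpace X] : ∀ (n : ℕ) (μ : Fin n → Measure X)
    [∀ i, SigmaFinite (μ i)] (f : Fin n → X → ℝ≥0∞) (_ : ∀ i, Measurable (f i)),
    ∫⁻ x, ∏ i, f i (x i) ∂(Measure.pi μ) = ∏ i, ∫⁻ x, f i x ∂(μ i) := by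
  intro n
  induction n with
  | zero =>
    intro μ _ f hf
    simp
  | succ n ih =>
    intro μ _ f hf
    have h := (measurePreserving_piFinSuccAbove μ 0).symm
    rw [← h.lintegral_comp_emb (MeasurableEquiv.measurableEmbedding _)]
    simp only [MeasurableEquiv.piFinSuccAbove_symm_apply, Fin.prod_univ_succ, Fin.insertNthEquiv_apply]
    simp only [Fin.insertNth_zero, Fin.cons_zero, Fin.cons_succ, cast_eq]
    rw [lintegral_prod_mul (g := fun y : Fin n → X => ∏ i, f i.succ (y i)) (hf 0).aemeasurable]
    · congr 1
      exact ih (fun i => μ i.succ) (fun i => f i.succ) (fun i => hf i.succ)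
    · exact (Finset.measurable_prod _ fun i _ => (hf i.succ).comp (measurable_pi_apply i)).aemeasurable

lemma pi_withDensity' {X : Type*} [MeasurableSpace X] (n : ℕ) (μ : Fin n → Measure X)
    [∀ i, SigmaFinite (μ i)] (f : Fin n → X → ℝ≥0∞) (hf : ∀ i, Measurable (f i))
    [∀ i, SigmaFinite ((μ i).withDensity (f i))] :
    Measure.pi (fun i => (μ i).withDensity (f i))
      = (Measure.pi μ).withDensity (fun x => ∏ i, f i (x i)) := by
  refine Measure.pi_eq fun s hs => ?_
  rw [withDensity_apply _ (MeasurableSet.univ_pi hs), ← lintegral_indicator (MeasurableSet.univ_pi hs)]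
  have : ∀ x : Fin n → X, (Set.univ.pi s).indicator (fun x => ∏ i, f i (x i)) x
      = ∏ i, (s i).indicator (f i) (x i) := by
    intro x
    by_cases hx : x ∈ Set.univ.pi s
    · rw [Set.indicator_of_mem hx]
      refine Finset.prod_congr rfl fun i _ => ?_
      rw [Set.indicator_of_mem (hx i (Set.mem_univ i))]
    · rw [Set.indicator_of_notMem hx]
      simp only [Set.mem_pi, Set.mem_univ, true_implies, not_forall] at hx
      obtain ⟨i, hi⟩ := hx
      exact (Finset.prod_eq_zero (Finset.mem_univ i) (Set.indicator_of_notMem hi _)).symm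
  simp_rw [this]
  rw [lintegral_pi_prod n μ _ (fun i => (hf i).indicator (hs i))]
  refine Finset.prod_congr rfl fun i _ => ?_
  rw [withDensity_apply _ (hs i), lintegral_indicator (hs i)]

/-- Density of the standard Gaussian. -/
def stdDens (k : ℕ) (x : Fin k → ℝ) : ℝ := ((√(2 * π))⁻¹) ^ k * Real.exp (-(x ⬝ᵥ x) / 2)

lemma continuous_stdDens (k : ℕ) : Continuous (stdDens k) := by
  unfold stdDens; fun_prop

instance (ι : Type*) [Fintype ι] : IsProbabilityMeasure (stdGaussian ι) := by
  unfold stdGaussian; infer_instance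

instance (n m : ℕ) : IsProbabilityMeasure (gaussianMatrix n m) := by
  unfold gaussianMatrix; infer_instance

lemma stdGaussian_eq_withDensity (k : ℕ) :
    stdGaussian (Fin k) = volume.withDensity (fun x => ENNReal.ofReal (stdDens k x)) := by
  have h1 : gaussianReal 0 1 = (volume : Measure ℝ).withDensity (gaussianPDF 0 1) :=
    gaussianReal_of_var_ne_zero 0 one_ne_zero
  have : IsProbabilityMeasure ((volume : Measure ℝ).withDensity (gaussianPDF 0 1)) := by
    rw [← h1]; infer_instance
  unfold stdGaussian
  rw [h1, pi_withDensity' k (fun _ => volume) (fun _ => gaussianPDF 0 1)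
    (fun _ => measurable_gaussianPDF 0 1), volume_pi]
  congr 1
  ext x
  simp only [gaussianPDF, gaussianPDFReal]
  rw [← ENNReal.ofReal_prod_of_nonneg (fun i _ => by positivity)]
  congr 1
  rw [Finset.prod_mul_distrib, ← Real.exp_sum]
  simp only [stdDens, dotProduct]
  simp [← Finset.sum_div, ← sq]

/-- Linear image of standard Gaussian. -/
lemma map_stdGaussian (k : ℕ) (T S : Matrix (Fin k) (Fin k) ℝ) (hTS : T * S = 1) :
    Measure.map (fun x => T *ᵥ x) (stdGaussian (Fin k))
      = volume.withDensity (fun x => ENNReal.ofReal (|T.det⁻¹| * stdDens k (S *ᵥ x))) := by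
  have hST : S * T = 1 := mul_eq_one_comm.mp hTS
  have hdet : T.det ≠ 0 := by
    intro h
    have := congrArg Matrix.det hTS
    simp [h] at this
  have hm : Measurable (fun x : Fin k → ℝ => T *ᵥ x) := by
    exact (Continuous.matrix_mulVec continuous_const continuous_id).measurable
  have hmS : Measurable (fun x : Fin k → ℝ => S *ᵥ x) := by
    exact (Continuous.matrix_mulVec continuous_const continuous_id).measurable
  have hvol := Real.map_matrix_volume_pi_eq_smul_volume_pi hdet
  have hd : Measurable fun x => ENNReal.ofReal (stdDens k x) :=
    (continuous_stdDens k).measurable.ennreal_ofReal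
  rw [stdGaussian_eq_withDensity]
  refine Measure.ext_of_lintegral _ fun g hg => ?_
  have hc : ∀ x : Fin k → ℝ, ENNReal.ofReal (|T.det⁻¹| * stdDens k (S *ᵥ x))
      = ENNReal.ofReal |T.det⁻¹| * ENNReal.ofReal (stdDens k (S *ᵥ x)) := fun x =>
    ENNReal.ofReal_mul (abs_nonneg _)
  simp_rw [hc]
  rw [lintegral_map hg hm, lintegral_withDensity_eq_lintegral_mul _ hd (g := fun x => g (T *ᵥ x))
    (by exact hg.comp hm),
    lintegral_withDensity_eq_lintegral_mul _ (by exact (hd.comp hmS).const_mul _) hg]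
  have : ∫⁻ x, (fun x => ENNReal.ofReal (stdDens k (S *ᵥ x)) * g x) x
      ∂(Measure.map (toLin' T) volume) = ENNReal.ofReal |T.det⁻¹| *
      ∫⁻ x, (fun x => ENNReal.ofReal (stdDens k (S *ᵥ x)) * g x) x := by
    rw [hvol, lintegral_smul_measure]; rfl
  rw [lintegral_map (by exact (hd.comp hmS).mul hg) (by exact hm)] at this
  simp only [Pi.mul_apply, mul_assoc]
  rw [lintegral_const_mul _ (by exact (hd.comp hmS).mul hg)]
  rw [← this]
  simp [Matrix.mulVec_mulVec, hST]

/-! ### Row laws -/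

/-- Square root of the covariance. -/
def Tmat {k r : ℕ} (lam : ℝ) (V : Matrix (Fin k) (Fin r) ℝ) : Matrix (Fin k) (Fin k) ℝ :=
  1 + (√(1 + lam) - 1) • (V * Vᵀ)

/-- Inverse square root of the covariance. -/
def Smat {k r : ℕ} (lam : ℝ) (V : Matrix (Fin k) (Fin r) ℝ) : Matrix (Fin k) (Fin k) ℝ :=
  1 - (1 - (√(1 + lam))⁻¹) • (V * Vᵀ)

lemma proj_idem {k r : ℕ} {V : Matrix (Fin k) (Fin r) ℝ} (hV : IsOrthonormalCols V) :
    (V * Vᵀ) * (V * Vᵀ) = V * Vᵀ := by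
  rw [Matrix.mul_assoc, ← Matrix.mul_assoc Vᵀ, hV, Matrix.one_mul]

lemma poly_proj {k : ℕ} (P : Matrix (Fin k) (Fin k) ℝ) (hP : P * P = P) (a b : ℝ) :
    (1 + a • P) * (1 + b • P) = 1 + (a + b + a * b) • P := by
  rw [Matrix.mul_add, Matrix.add_mul, Matrix.add_mul]
  simp only [Matrix.mul_one, Matrix.one_mul, Matrix.smul_mul, Matrix.mul_smul, hP, smul_smul, add_smul]
  rw [mul_comm b a]
  abel

lemma Tmat_mul_Smat {k r : ℕ} {lam : ℝ} (hl : 0 < lam) {V : Matrix (Fin k) (Fin r) ℝ}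
    (hV : IsOrthonormalCols V) : Tmat lam V * Smat lam V = 1 := by
  have hs : √(1 + lam) ≠ 0 := by positivity
  have : Smat lam V = 1 + (-(1 - (√(1 + lam))⁻¹)) • (V * Vᵀ) := by
    unfold Smat; rw [neg_smul, sub_eq_add_neg]
  rw [this, Tmat, poly_proj _ (proj_idem hV)]
  have : (√(1 + lam) - 1 + -(1 - (√(1 + lam))⁻¹) + (√(1 + lam) - 1) * -(1 - (√(1 + lam))⁻¹)) = 0 := by
    field_simp; ring
  rw [this]; simp

lemma Smat_mul_Smat {k r : ℕ} {lam : ℝ} (hl : 0 < lam) {V : Matrix (Fin k) (Fin r) ℝ}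
    (hV : IsOrthonormalCols V) :
    Smat lam V * Smat lam V = 1 - (lam / (lam + 1)) • (V * Vᵀ) := by
  have hs : √(1 + lam) ≠ 0 := by positivity
  have hs2 : √(1 + lam) ^ 2 = 1 + lam := Real.sq_sqrt (by positivity)
  have : Smat lam V = 1 + (-(1 - (√(1 + lam))⁻¹)) • (V * Vᵀ) := by
    unfold Smat; rw [neg_smul, sub_eq_add_neg]
  rw [this, poly_proj _ (proj_idem hV), sub_eq_add_neg (1 : Matrix (Fin k) (Fin k) ℝ), ← neg_smul]
  congr 2
  have h1 : lam = √(1 + lam) ^ 2 - 1 := by rw [hs2]; ring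
  have h2 : lam / (lam + 1) = (√(1 + lam) ^ 2 - 1) / √(1 + lam) ^ 2 := by
    rw [hs2]; ring
  rw [h2]
  field_simp; ring

lemma Tmat_mul_Tmat {k r : ℕ} {lam : ℝ} (hl : 0 < lam) {V : Matrix (Fin k) (Fin r) ℝ}
    (hV : IsOrthonormalCols V) :
    Tmat lam V * Tmat lam V = 1 + lam • (V * Vᵀ) := by
  have hs2 : √(1 + lam) ^ 2 = 1 + lam := Real.sq_sqrt (by positivity)
  rw [Tmat, poly_proj _ (proj_idem hV)]
  congr 2
  linear_combination hs2

lemma Tmat_transpose {k r : ℕ} (lam : ℝ) (V : Matrix (Fin k) (Fin r) ℝ) :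
    (Tmat lam V)ᵀ = Tmat lam V := by
  simp [Tmat, Matrix.transpose_mul]

lemma Smat_transpose {k r : ℕ} (lam : ℝ) (V : Matrix (Fin k) (Fin r) ℝ) :
    (Smat lam V)ᵀ = Smat lam V := by
  simp [Smat, Matrix.transpose_mul]

lemma Tmat_det {k r : ℕ} (lam : ℝ) {V : Matrix (Fin k) (Fin r) ℝ}
    (hV : IsOrthonormalCols V) : (Tmat lam V).det = (√(1 + lam)) ^ r := by
  rw [Tmat, ← Matrix.smul_mul, Matrix.det_one_add_mul_comm, Matrix.mul_smul, hV]
  have : (1 + (√(1 + lam) - 1) • (1 : Matrix (Fin r) (Fin r) ℝ)) = √(1 + lam) • 1 := by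
    rw [sub_smul, one_smul]; abel
  rw [this, Matrix.det_smul]; simp

lemma charFunDual_stdG (k : ℕ) (L : StrongDual ℝ (Fin k → ℝ)) :
    charFunDual (stdGaussian (Fin k)) L
      = Complex.exp (-((∑ i, (L (Pi.single i 1)) ^ 2 : ℝ) : ℂ) / 2) := by
  unfold stdGaussian
  rw [charFunDual_pi]
  have : ∀ i, charFunDual (gaussianReal 0 1) (L ∘SL ContinuousLinearMap.single ℝ (fun _ => ℝ) i)
      = Complex.exp (-(((L (Pi.single i 1)) ^ 2 : ℝ) : ℂ) / 2) := by
    intro i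
    rw [charFunDual_eq_charFun_map_one]
    have h2 : Measure.map (⇑(L ∘SL ContinuousLinearMap.single ℝ (fun _ => ℝ) i)) (gaussianReal 0 1)
      = Measure.map (fun x => (L (Pi.single i 1)) * x) (gaussianReal 0 1) := by
      congr 1
      ext x
      have : (Pi.single i x : Fin k → ℝ) = x • Pi.single i 1 := by
        rw [← Pi.single_smul]; simp
      simp only [ContinuousLinearMap.coe_comp, Function.comp, ContinuousLinearMap.single_apply]
      simp [this, mul_comm]
    rw [h2, gaussianReal_map_const_mul, charFun_gaussianReal]
    congr 1
    push_cast
    simp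
    ring
  simp_rw [this]
  rw [← Complex.exp_sum]
  congr 1
  rw [← Finset.sum_div]
  push_cast
  simp

/-- Law of a row. -/
def rowLaw (k r : ℕ) (lam : ℝ) (V : Matrix (Fin k) (Fin r) ℝ) : Measure (Fin k → ℝ) :=
  Measure.map (fun w : (Fin r → ℝ) × (Fin k → ℝ) =>
      fun j => (∑ l, w.1 l * √lam * V j l) + √1 * w.2 j)
    ((stdGaussian (Fin r)).prod (stdGaussian (Fin k)))

lemma dual_sq_sum {k : ℕ} (L : StrongDual ℝ (Fin k → ℝ)) (x : Fin k → ℝ) :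
    L x = (fun i => L (Pi.single i 1)) ⬝ᵥ x := by
  conv_lhs => rw [← Finset.univ_sum_single x]
  rw [map_sum]
  refine Finset.sum_congr rfl fun i _ => ?_
  have : (Pi.single i (x i) : Fin k → ℝ) = x i • Pi.single i 1 := by
    rw [← Pi.single_smul]; simp
  rw [this, map_smul, smul_eq_mul, mul_comm]

lemma rowLaw_eq {k r : ℕ} {lam : ℝ} (hl : 0 < lam) {V : Matrix (Fin k) (Fin r) ℝ}
    (hV : IsOrthonormalCols V) :
    rowLaw k r lam V = Measure.map (fun x => Tmat lam V *ᵥ x) (stdGaussian (Fin k)) := by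
  let A : ((Fin r → ℝ) × (Fin k → ℝ)) →L[ℝ] (Fin k → ℝ) :=
    ((toLin' (√lam • V)).coprod LinearMap.id).toContinuousLinearMap
  let B : (Fin k → ℝ) →L[ℝ] (Fin k → ℝ) := (toLin' (Tmat lam V)).toContinuousLinearMap
  have hA : (fun w : (Fin r → ℝ) × (Fin k → ℝ) =>
      fun j => (∑ l, w.1 l * √lam * V j l) + √1 * w.2 j) = A := by
    ext w j
    simp only [A, LinearMap.coe_toContinuousLinearMap', LinearMap.coprod_apply, toLin'_apply,
      LinearMap.id_apply, Pi.add_apply, Real.sqrt_one, one_mul, mulVec, dotProduct, Matrix.smul_apply,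
      smul_eq_mul]
    congr 1
    exact Finset.sum_congr rfl fun i _ => by ring
  have hB : (fun x => Tmat lam V *ᵥ x) = B := by
    ext w j
    simp [B]
  unfold rowLaw
  rw [hA, hB]
  have : IsProbabilityMeasure (Measure.map A ((stdGaussian (Fin r)).prod (stdGaussian (Fin k)))) :=
    Measure.isProbabilityMeasure_map A.continuous.aemeasurable
  have : IsProbabilityMeasure (Measure.map B (stdGaussian (Fin k))) :=
    Measure.isProbabilityMeasure_map B.continuous.aemeasurable
  refine Measure.ext_of_charFunDual ?_
  ext L
  rw [charFunDual_map, charFunDual_map, charFunDual_prod, charFunDual_stdG, charFunDual_stdG,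
    charFunDual_stdG, ← Complex.exp_add]
  congr 1
  set u : Fin k → ℝ := fun i => L (Pi.single i 1) with hu
  have e1 : ∀ i, ((L ∘SL A) ∘SL ContinuousLinearMap.inl ℝ (Fin r → ℝ) (Fin k → ℝ)) (Pi.single i 1)
      = √lam * (u ᵥ* V) i := by
    intro i
    simp only [ContinuousLinearMap.coe_comp, Function.comp, ContinuousLinearMap.inl_apply, A,
      LinearMap.coe_toContinuousLinearMap', LinearMap.coprod_apply, toLin'_apply, map_zero, add_zero]
    rw [dual_sq_sum, dotProduct_mulVec]
    simp [vecMul_smul, hu]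
  have e2 : ∀ i, ((L ∘SL A) ∘SL ContinuousLinearMap.inr ℝ (Fin r → ℝ) (Fin k → ℝ)) (Pi.single i 1)
      = u i := by
    intro i
    simp [A, hu]
  have e3 : ∀ i, (L ∘SL B) (Pi.single i 1) = (u ᵥ* Tmat lam V) i := by
    intro i
    simp only [ContinuousLinearMap.coe_comp, Function.comp, B,
      LinearMap.coe_toContinuousLinearMap', toLin'_apply]
    rw [dual_sq_sum, dotProduct_mulVec]
    simp [hu]
  simp_rw [e1, e2, e3]
  have key : ∑ i, ((u ᵥ* Tmat lam V) i) ^ 2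
      = ∑ i, (√lam * (u ᵥ* V) i) ^ 2 + ∑ i, (u i) ^ 2 := by
    have h1 : ∑ i, ((u ᵥ* Tmat lam V) i) ^ 2 = (u ᵥ* Tmat lam V) ⬝ᵥ (Tmat lam V *ᵥ u) := by
      rw [← Matrix.vecMul_transpose, Tmat_transpose]
      simp [dotProduct, sq]
    have h2 : ∑ i, (√lam * (u ᵥ* V) i) ^ 2 = lam * ((u ᵥ* V) ⬝ᵥ (Vᵀ *ᵥ u)) := by
      rw [← Matrix.vecMul_transpose, Matrix.transpose_transpose]
      simp only [mul_pow, Real.sq_sqrt hl.le, dotProduct, Finset.mul_sum]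
      simp only [sq]
    rw [h1, h2, ← dotProduct_mulVec, ← dotProduct_mulVec, Matrix.mulVec_mulVec, Matrix.mulVec_mulVec,
      Tmat_mul_Tmat hl hV]
    simp only [Matrix.add_mulVec, Matrix.one_mulVec, Matrix.smul_mulVec, dotProduct_add, dotProduct_smul,
      smul_eq_mul]
    rw [add_comm]
    congr 1
    simp [dotProduct, sq]
  rw [key]
  push_cast
  ring

/-! ### Likelihood ratios -/

lemma measurable_rowMap {k r : ℕ} (lam : ℝ) (V : Matrix (Fin k) (Fin r) ℝ) :
    Measurable (fun w : (Fin r → ℝ) × (Fin k → ℝ) =>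
      fun j => (∑ l, w.1 l * √lam * V j l) + √1 * w.2 j) := by
  refine Continuous.measurable ?_
  fun_prop

instance {k r : ℕ} (lam : ℝ) (V : Matrix (Fin k) (Fin r) ℝ) :
    IsProbabilityMeasure (rowLaw k r lam V) :=
  Measure.isProbabilityMeasure_map (measurable_rowMap lam V).aemeasurable

lemma spiked_eq_pi (n : ℕ) {k r : ℕ} (lam : ℝ) (V : Matrix (Fin k) (Fin r) ℝ) :
    spikedMeasure n k r (fun _ => lam) V 1 = Measure.pi (fun _ : Fin n => rowLaw k r lam V) := by
  unfold spikedMeasure rowLaw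
  rw [← Measure.pi_map_pi (fun _ => (measurable_rowMap lam V).aemeasurable)]
  have h := (measurePreserving_arrowProdEquivProdArrow (Fin r → ℝ) (Fin k → ℝ) (Fin n)
    (fun _ => stdGaussian (Fin r)) (fun _ => stdGaussian (Fin k)))
  unfold gaussianMatrix
  rw [← h.map_eq, Measure.map_map _ h.measurable]
  · rfl
  · refine Continuous.measurable ?_
    fun_prop

instance (n : ℕ) {k r : ℕ} (lam : ℝ) (V : Matrix (Fin k) (Fin r) ℝ) :
    IsProbabilityMeasure (spikedMeasure n k r (fun _ => lam) V 1) := by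
  rw [spiked_eq_pi]; infer_instance

/-- Quadratic form. -/
def qf {k : ℕ} (A : Matrix (Fin k) (Fin k) ℝ) (x : Fin k → ℝ) : ℝ := x ⬝ᵥ (A *ᵥ x)

lemma continuous_qf {k : ℕ} (A : Matrix (Fin k) (Fin k) ℝ) : Continuous (qf A) := by
  unfold qf
  exact continuous_id.dotProduct (continuous_const.matrix_mulVec continuous_id)

lemma rowLaw_density {k r : ℕ} {lam : ℝ} (hl : 0 < lam) {V : Matrix (Fin k) (Fin r) ℝ}
    (hV : IsOrthonormalCols V) :
    rowLaw k r lam V = volume.withDensity (fun x => ENNReal.ofReal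
      (|((√(1 + lam)) ^ r)⁻¹| * (((√(2 * π))⁻¹) ^ k *
        Real.exp (-(x ⬝ᵥ x - lam / (lam + 1) * qf (V * Vᵀ) x) / 2)))) := by
  rw [rowLaw_eq hl hV, map_stdGaussian k _ _ (Tmat_mul_Smat hl hV), Tmat_det lam hV]
  congr 1
  ext x
  have : (Smat lam V *ᵥ x) ⬝ᵥ (Smat lam V *ᵥ x) = x ⬝ᵥ x - lam / (lam + 1) * qf (V * Vᵀ) x := by
    conv_lhs => enter [1]; rw [← Smat_transpose, Matrix.mulVec_transpose]
    rw [← dotProduct_mulVec, Matrix.mulVec_mulVec, Smat_mul_Smat hl hV]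
    simp [Matrix.sub_mulVec, Matrix.smul_mulVec, qf]
  rw [stdDens, this]

lemma rowLaw_tilt {k r : ℕ} {lam : ℝ} (hl : 0 < lam) {V W : Matrix (Fin k) (Fin r) ℝ}
    (hV : IsOrthonormalCols V) (hW : IsOrthonormalCols W) :
    rowLaw k r lam W = (rowLaw k r lam V).withDensity (fun x => ENNReal.ofReal
      (Real.exp (lam / (lam + 1) / 2 * (qf (W * Wᵀ) x - qf (V * Vᵀ) x)))) := by
  rw [rowLaw_density hl hV, rowLaw_density hl hW, ← withDensity_mul]
  · congr 1
    ext x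
    simp only [Pi.mul_apply]
    rw [← ENNReal.ofReal_mul (by positivity), mul_assoc, mul_assoc, ← Real.exp_add]
    congr 4
    ring
  · refine Measurable.ennreal_ofReal (Continuous.measurable ?_)
    have := continuous_qf (V * Vᵀ)
    fun_prop
  · refine Measurable.ennreal_ofReal (Continuous.measurable ?_)
    have := continuous_qf (V * Vᵀ)
    have := continuous_qf (W * Wᵀ)
    fun_prop

/-- Log likelihood ratio. -/
def llr {n k r : ℕ} (lam : ℝ) (V W : Matrix (Fin k) (Fin r) ℝ) (x : Fin n → Fin k → ℝ) : ℝ :=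
  ∑ i, lam / (lam + 1) / 2 * (qf (W * Wᵀ) (x i) - qf (V * Vᵀ) (x i))

lemma continuous_llr {n k r : ℕ} (lam : ℝ) (V W : Matrix (Fin k) (Fin r) ℝ) :
    Continuous (llr (n := n) lam V W) := by
  unfold llr
  have := continuous_qf (V * Vᵀ)
  have := continuous_qf (W * Wᵀ)
  fun_prop

lemma spiked_tilt (n : ℕ) {k r : ℕ} {lam : ℝ} (hl : 0 < lam) {V W : Matrix (Fin k) (Fin r) ℝ}
    (hV : IsOrthonormalCols V) (hW : IsOrthonormalCols W) :
    spikedMeasure n k r (fun _ => lam) W 1 = (spikedMeasure n k r (fun _ => lam) V 1).withDensity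
      (fun x => ENNReal.ofReal (Real.exp (llr lam V W x))) := by
  rw [spiked_eq_pi, spiked_eq_pi]
  have ht := rowLaw_tilt hl hV hW
  have : IsProbabilityMeasure ((rowLaw k r lam V).withDensity (fun x => ENNReal.ofReal
      (Real.exp (lam / (lam + 1) / 2 * (qf (W * Wᵀ) x - qf (V * Vᵀ) x))))) := by
    rw [← ht]; infer_instance
  rw [ht, pi_withDensity']
  · congr 1
    ext x
    rw [← ENNReal.ofReal_prod_of_nonneg (fun i _ => by positivity), llr, Real.exp_sum]
  · intro i
    refine Measurable.ennreal_ofReal (Continuous.measurable ?_)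
    have := continuous_qf (V * Vᵀ)
    have := continuous_qf (W * Wᵀ)
    fun_prop

lemma std_second_moment (k : ℕ) (a b : Fin k) :
    Integrable (fun z : Fin k → ℝ => z a * z b) (stdGaussian (Fin k)) ∧
    ∫ z, z a * z b ∂(stdGaussian (Fin k)) = (1 : Matrix (Fin k) (Fin k) ℝ) a b := by
  have hL2 : MemLp id 2 (gaussianReal 0 1) := memLp_id_gaussianReal 2
  have hm : ∀ a : Fin k, MemLp (fun z : Fin k → ℝ => z a) 2 (stdGaussian (Fin k)) := fun a =>
    hL2.comp_measurePreserving (measurePreserving_eval (fun _ => gaussianReal 0 1) a)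
  refine ⟨(hm a).integrable_mul (hm b), ?_⟩
  by_cases hab : a = b
  · subst hab
    rw [Matrix.one_apply_eq]
    have h := integral_comp_eval (μ := fun _ : Fin k => gaussianReal 0 1) (i := a)
      (f := fun x : ℝ => x * x) (by fun_prop)
    rw [stdGaussian, h]
    have hv := variance_id_gaussianReal (μ := 0) (v := 1)
    rw [variance_eq_integral (by fun_prop)] at hv
    simpa [sq] using hv
  · rw [Matrix.one_apply_ne hab]
    have hind := iIndepFun_pi (μ := fun _ : Fin k => gaussianReal 0 1) (X := fun _ => id)
      (fun _ => aemeasurable_id)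
    have := (hind.indepFun hab).integral_mul_eq_mul_integral
      (by exact (measurable_pi_apply a).aestronglyMeasurable)
      (by exact (measurable_pi_apply b).aestronglyMeasurable)
    simp only [Pi.mul_apply, id] at this
    rw [stdGaussian, this]
    have h := integral_comp_eval (μ := fun _ : Fin k => gaussianReal 0 1) (i := a)
      (f := fun x : ℝ => x) (by fun_prop)
    rw [h]
    simp

lemma std_qf (k : ℕ) (A : Matrix (Fin k) (Fin k) ℝ) :
    Integrable (qf A) (stdGaussian (Fin k)) ∧ ∫ z, qf A z ∂(stdGaussian (Fin k)) = A.trace := by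
  have e : qf A = fun z => ∑ a, ∑ b, A a b * (z a * z b) := by
    ext z
    simp only [qf, dotProduct, mulVec, Finset.mul_sum]
    exact Finset.sum_congr rfl fun a _ => Finset.sum_congr rfl fun b _ => by ring
  rw [e]
  have hi : ∀ a b, Integrable (fun z : Fin k → ℝ => A a b * (z a * z b)) (stdGaussian (Fin k)) :=
    fun a b => (std_second_moment k a b).1.const_mul _
  refine ⟨integrable_finsetSum _ fun a _ => integrable_finsetSum _ fun b _ => hi a b, ?_⟩
  rw [integral_finsetSum _ fun a _ => integrable_finsetSum _ fun b _ => hi a b]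
  refine Finset.sum_congr rfl fun a _ => ?_
  rw [integral_finsetSum _ fun b _ => hi a b]
  simp_rw [integral_const_mul, (std_second_moment k _ _).2, Matrix.one_apply]
  simp

lemma rowLaw_qf {k r : ℕ} {lam : ℝ} (hl : 0 < lam) {V : Matrix (Fin k) (Fin r) ℝ}
    (hV : IsOrthonormalCols V) (A : Matrix (Fin k) (Fin k) ℝ) :
    Integrable (qf A) (rowLaw k r lam V) ∧
    ∫ z, qf A z ∂(rowLaw k r lam V) = (A * (1 + lam • (V * Vᵀ))).trace := by
  have hm : Measurable (fun x : Fin k → ℝ => Tmat lam V *ᵥ x) :=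
    (Continuous.matrix_mulVec continuous_const continuous_id).measurable
  have e : ∀ z, qf A (Tmat lam V *ᵥ z) = qf (Tmat lam V * A * Tmat lam V) z := by
    intro z
    unfold qf
    rw [← Matrix.mulVec_mulVec, ← Matrix.mulVec_mulVec]
    conv_lhs => enter [1]; rw [← Tmat_transpose, Matrix.mulVec_transpose]
    rw [dotProduct_mulVec z]
  rw [rowLaw_eq hl hV]
  constructor
  · rw [integrable_map_measure (continuous_qf A).aestronglyMeasurable hm.aemeasurable]
    simp only [Function.comp_def, e]
    exact (std_qf k _).1
  · rw [integral_map hm.aemeasurable (continuous_qf A).aestronglyMeasurable]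
    simp only [e]
    rw [(std_qf k _).2, Matrix.mul_assoc, Matrix.trace_mul_comm, Matrix.mul_assoc, Tmat_mul_Tmat hl hV]

/-! ### Two-point lower bound -/

lemma frobSq_eq_trace {m k : Type*} [Fintype m] [Fintype k] (A : Matrix m k ℝ) :
    frobSq A = (Aᵀ * A).trace := by
  simp only [frobSq, Matrix.trace, Matrix.diag, Matrix.mul_apply, Matrix.transpose_apply]
  rw [Finset.sum_comm]
  simp [sq]

lemma frobSq_nonneg {m k : Type*} [Fintype m] [Fintype k] (A : Matrix m k ℝ) : 0 ≤ frobSq A :=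
  Finset.sum_nonneg fun _ _ => Finset.sum_nonneg fun _ _ => sq_nonneg _

lemma trace_proj {k r : ℕ} {V : Matrix (Fin k) (Fin r) ℝ} (hV : IsOrthonormalCols V) :
    (V * Vᵀ).trace = r := by
  rw [Matrix.trace_mul_comm, hV]; simp

lemma loss_eq {k r : ℕ} {V W : Matrix (Fin k) (Fin r) ℝ} (hV : IsOrthonormalCols V)
    (hW : IsOrthonormalCols W) :
    loss V W = 2 * r - 2 * ((V * Vᵀ) * (W * Wᵀ)).trace := by
  rw [loss, frobSq_eq_trace]
  simp only [Matrix.transpose_sub, Matrix.transpose_mul, Matrix.transpose_transpose]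
  rw [Matrix.mul_sub, Matrix.sub_mul, Matrix.sub_mul, proj_idem hV, proj_idem hW]
  simp only [Matrix.trace_sub, trace_proj hV, trace_proj hW]
  rw [Matrix.trace_mul_comm (W * Wᵀ)]
  ring

lemma integral_llr (n : ℕ) {k r : ℕ} {lam : ℝ} (hl : 0 < lam) {V W : Matrix (Fin k) (Fin r) ℝ}
    (hV : IsOrthonormalCols V) (hW : IsOrthonormalCols W) :
    Integrable (llr lam V W) (spikedMeasure n k r (fun _ => lam) V 1) ∧
    ∫ x, llr lam V W x ∂(spikedMeasure n k r (fun _ => lam) V 1)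
      = -(n * hfun lam / 4 * loss V W) := by
  rw [spiked_eq_pi]
  have hi : Integrable (fun x => lam / (lam + 1) / 2 * (qf (W * Wᵀ) x - qf (V * Vᵀ) x))
      (rowLaw k r lam V) :=
    ((rowLaw_qf hl hV _).1.sub (rowLaw_qf hl hV _).1).const_mul _
  have hi' : ∀ i : Fin n, Integrable (fun x : Fin n → Fin k → ℝ =>
      lam / (lam + 1) / 2 * (qf (W * Wᵀ) (x i) - qf (V * Vᵀ) (x i)))
      (Measure.pi (fun _ : Fin n => rowLaw k r lam V)) := fun i =>
    integrable_comp_eval (μ := fun _ : Fin n => rowLaw k r lam V) (i := i) hi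
  refine ⟨integrable_finsetSum _ fun i _ => hi' i, ?_⟩
  unfold llr
  rw [integral_finsetSum _ fun i _ => hi' i]
  have : ∀ i : Fin n, ∫ x : Fin n → Fin k → ℝ,
      lam / (lam + 1) / 2 * (qf (W * Wᵀ) (x i) - qf (V * Vᵀ) (x i))
      ∂(Measure.pi (fun _ : Fin n => rowLaw k r lam V)) = -(hfun lam / 4 * loss V W) := by
    intro i
    rw [integral_comp_eval (μ := fun _ : Fin n => rowLaw k r lam V) (i := i)
      (f := fun x => lam / (lam + 1) / 2 * (qf (W * Wᵀ) x - qf (V * Vᵀ) x)) hi.aestronglyMeasurable,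
      integral_const_mul, integral_sub (rowLaw_qf hl hV _).1 (rowLaw_qf hl hV _).1,
      (rowLaw_qf hl hV _).2, (rowLaw_qf hl hV _).2, loss_eq hV hW]
    simp only [Matrix.mul_add, Matrix.mul_one, Matrix.mul_smul, Matrix.trace_add, Matrix.trace_smul,
      proj_idem hV, trace_proj hV, trace_proj hW, smul_eq_mul]
    rw [Matrix.trace_mul_comm (W * Wᵀ), hfun]
    field_simp
    ring
  simp_rw [this]
  simp
  ring

lemma pointwise_bound (f g c l : ℝ) (hf : 0 ≤ f) (hg : 0 ≤ g) (hc : 0 ≤ c) (h : c ≤ f + g) :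
    c * (5 / 8 + 3 / 8 * l - Real.exp l / 8) ≤ f + Real.exp l * g := by
  set s := Real.exp (l / 2) with hs
  have hsl : Real.exp l = s ^ 2 := by rw [hs, sq, ← Real.exp_add]; congr 1; ring
  have h1 : 1 + l / 2 ≤ s := by
    have := Real.add_one_le_exp (l / 2); rw [hs]; linarith
  have hs0 : 0 < s := Real.exp_pos _
  rw [hsl]
  have h2 : c * (5 / 8 + 3 / 8 * l - s ^ 2 / 8) ≤ c * (3 / 4 * s - 1 / 8 - s ^ 2 / 8) :=
    mul_le_mul_of_nonneg_left (by linarith) hc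
  refine h2.trans ?_
  rcases le_total (s ^ 2) 1 with ht | ht
  · have h3 : c * (3 / 4 * s - 1 / 8 - s ^ 2 / 8) ≤ c * s ^ 2 :=
      mul_le_mul_of_nonneg_left (by nlinarith [sq_nonneg (3 * s - 1)]) hc
    have h4 : c * s ^ 2 ≤ (f + g) * s ^ 2 := mul_le_mul_of_nonneg_right h (by positivity)
    nlinarith
  · have h3 : c * (3 / 4 * s - 1 / 8 - s ^ 2 / 8) ≤ c * 1 :=
      mul_le_mul_of_nonneg_left (by nlinarith [sq_nonneg (s - 3)]) hc
    nlinarith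

lemma two_point (n : ℕ) {k r : ℕ} {lam : ℝ} (hl : 0 < lam) {V W : Matrix (Fin k) (Fin r) ℝ}
    (hV : IsOrthonormalCols V) (hW : IsOrthonormalCols W) (f g : (Fin n → Fin k → ℝ) → ℝ)
    (hf : ∀ x, 0 ≤ f x) (hg : ∀ x, 0 ≤ g x) (c : ℝ) (hc : 0 ≤ c) (hfg : ∀ x, c ≤ f x + g x)
    (hfi : Integrable f (spikedMeasure n k r (fun _ => lam) V 1))
    (hgi : Integrable g (spikedMeasure n k r (fun _ => lam) W 1)) :
    c * (1 / 2 - 3 / 8 * (n * hfun lam / 4 * loss V W)) ≤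
      ∫ x, f x ∂(spikedMeasure n k r (fun _ => lam) V 1)
        + ∫ x, g x ∂(spikedMeasure n k r (fun _ => lam) W 1) := by
  set μ := spikedMeasure n k r (fun _ => lam) V 1 with hμ
  have ht := spiked_tilt n hl hV hW
  rw [← hμ] at ht
  have hprob : IsProbabilityMeasure (spikedMeasure n k r (fun _ => lam) W 1) := inferInstance
  have hml : Measurable (fun x => ENNReal.ofReal (Real.exp (llr (n := n) lam V W x))) :=
    (Real.continuous_exp.comp (continuous_llr lam V W)).measurable.ennreal_ofReal
  have hlt : ∀ᵐ x ∂μ, ENNReal.ofReal (Real.exp (llr (n := n) lam V W x)) < ⊤ :=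
    Filter.Eventually.of_forall fun x => ENNReal.ofReal_lt_top
  rw [ht] at hgi hprob ⊢
  rw [integrable_withDensity_iff_integrable_smul' hml hlt] at hgi
  rw [integral_withDensity_eq_integral_toReal_smul hml hlt]
  have e : ∀ x, (ENNReal.ofReal (Real.exp (llr (n := n) lam V W x))).toReal
      = Real.exp (llr lam V W x) := fun x => ENNReal.toReal_ofReal (Real.exp_pos _).le
  have h1 : Integrable (fun x => Real.exp (llr (n := n) lam V W x)) μ := by
    have : Integrable (fun _ : Fin n → Fin k → ℝ => (1 : ℝ)) (μ.withDensity
      (fun x => ENNReal.ofReal (Real.exp (llr lam V W x)))) := integrable_const _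
    rw [integrable_withDensity_iff_integrable_smul' hml hlt] at this
    simpa [e] using this
  have h2 : ∫ x, Real.exp (llr (n := n) lam V W x) ∂μ = 1 := by
    have : ∫ x : Fin n → Fin k → ℝ, (1 : ℝ) ∂(μ.withDensity
      (fun x => ENNReal.ofReal (Real.exp (llr lam V W x)))) = 1 := by simp
    rw [integral_withDensity_eq_integral_toReal_smul hml hlt] at this
    simpa [e] using this
  simp only [e, smul_eq_mul] at hgi ⊢
  obtain ⟨h3, h4⟩ := integral_llr n hl hV hW
  rw [← hμ] at h3 h4
  rw [← integral_add hfi hgi]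
  have h5 : ∫ x, c * (5 / 8 + 3 / 8 * llr lam V W x - Real.exp (llr (n := n) lam V W x) / 8) ∂μ
      = c * (1 / 2 - 3 / 8 * (n * hfun lam / 4 * loss V W)) := by
    have hA : Integrable (fun x => 5 / 8 + 3 / 8 * llr (n := n) lam V W x) μ :=
      (integrable_const _).add (h3.const_mul _)
    rw [integral_const_mul, integral_sub hA (h1.div_const _),
      integral_add (integrable_const _) (h3.const_mul _), integral_const_mul, integral_div (8:ℝ) (fun x => Real.exp (llr (n := n) lam V W x)), h2, h4,
      integral_const]
    simp only [probReal_univ, smul_eq_mul]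
    ring
  rw [← h5]
  refine integral_mono ?_ (hfi.add hgi) fun x => ?_
  · exact (((integrable_const _).add (h3.const_mul _)).sub (h1.div_const _)).const_mul _
  · exact pointwise_bound _ _ _ _ (hf x) (hg x) hc (hfg x)

/-! ### The local parametrisation of subspaces by graphs -/

/-- The matrix `[I; B]`. -/
def Jm {r m : ℕ} (B : Matrix (Fin m) (Fin r) ℝ) : Matrix (Fin (r + m)) (Fin r) ℝ :=
  Matrix.of fun i a => Fin.addCases (fun b => (1 : Matrix (Fin r) (Fin r) ℝ) b a) (fun j => B j a) i

@[simp] lemma Jm_castAdd {r m : ℕ} (B : Matrix (Fin m) (Fin r) ℝ) (b a : Fin r) :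
    Jm B (Fin.castAdd m b) a = (1 : Matrix (Fin r) (Fin r) ℝ) b a := by
  simp [Jm]

@[simp] lemma Jm_natAdd {r m : ℕ} (B : Matrix (Fin m) (Fin r) ℝ) (j : Fin m) (a : Fin r) :
    Jm B (Fin.natAdd r j) a = B j a := by
  simp [Jm]

lemma Jm_transpose_mul {r m : ℕ} (B : Matrix (Fin m) (Fin r) ℝ) :
    (Jm B)ᵀ * Jm B = 1 + Bᵀ * B := by
  ext a b
  simp only [Matrix.mul_apply, Matrix.transpose_apply, Matrix.add_apply, Fin.sum_univ_add, Jm_castAdd,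
    Jm_natAdd, Matrix.one_apply]
  simp [eq_comm]

lemma Jm_sub_transpose_mul {r m : ℕ} (B C : Matrix (Fin m) (Fin r) ℝ) :
    (Jm B - Jm C)ᵀ * (Jm B - Jm C) = (B - C)ᵀ * (B - C) := by
  ext a b
  simp only [Matrix.mul_apply, Matrix.transpose_apply, Matrix.sub_apply, Fin.sum_univ_add, Jm_castAdd,
    Jm_natAdd]
  simp

open scoped MatrixOrder in
lemma exists_R {r m : ℕ} (B : Matrix (Fin m) (Fin r) ℝ) :
    ∃ R : Matrix (Fin r) (Fin r) ℝ, (R * Rᵀ) * (1 + Bᵀ * B) = 1 ∧ Rᵀ * (1 + Bᵀ * B) * R = 1 := by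
  have hpd : (1 + Bᵀ * B).PosDef := by
    refine Matrix.PosDef.add_posSemidef Matrix.PosDef.one ?_
    have := Matrix.posSemidef_conjTranspose_mul_self B
    rwa [Matrix.conjTranspose_eq_transpose_of_trivial] at this
  obtain ⟨y, hy, h⟩ := CStarAlgebra.isStrictlyPositive_iff_eq_star_mul_self.mp
        hpd.isStrictlyPositive
  rw [Matrix.star_eq_conjTranspose, Matrix.conjTranspose_eq_transpose_of_trivial] at h
  obtain ⟨u, rfl⟩ := hy
  set R : Matrix (Fin r) (Fin r) ℝ := ((u⁻¹ : (Matrix (Fin r) (Fin r) ℝ)ˣ) : Matrix (Fin r) (Fin r) ℝ)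
  have h1 : (u : Matrix (Fin r) (Fin r) ℝ) * R = 1 := u.mul_inv
  have h2 : R * (u : Matrix (Fin r) (Fin r) ℝ) = 1 := u.inv_mul
  have h3 : Rᵀ * (u : Matrix (Fin r) (Fin r) ℝ)ᵀ = 1 := by
    rw [← Matrix.transpose_mul, h1, Matrix.transpose_one]
  refine ⟨R, ?_, ?_⟩
  · rw [h, Matrix.mul_assoc, ← Matrix.mul_assoc Rᵀ, h3, Matrix.one_mul, h2]
  · rw [h, ← Matrix.mul_assoc, h3, Matrix.one_mul, h1]

/-- Normaliser. -/
def Rm {r m : ℕ} (B : Matrix (Fin m) (Fin r) ℝ) : Matrix (Fin r) (Fin r) ℝ := (exists_R B).choose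

/-- The inverse of `I + BᵀB`. -/
def Gm {r m : ℕ} (B : Matrix (Fin m) (Fin r) ℝ) : Matrix (Fin r) (Fin r) ℝ := Rm B * (Rm B)ᵀ

/-- The orthonormal frame. -/
def Vm {r m : ℕ} (B : Matrix (Fin m) (Fin r) ℝ) : Matrix (Fin (r + m)) (Fin r) ℝ := Jm B * Rm B

lemma Gm_mul {r m : ℕ} (B : Matrix (Fin m) (Fin r) ℝ) : Gm B * (1 + Bᵀ * B) = 1 :=
  (exists_R B).choose_spec.1

lemma mul_Gm {r m : ℕ} (B : Matrix (Fin m) (Fin r) ℝ) : (1 + Bᵀ * B) * Gm B = 1 :=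
  mul_eq_one_comm.mp (Gm_mul B)

lemma Gm_transpose {r m : ℕ} (B : Matrix (Fin m) (Fin r) ℝ) : (Gm B)ᵀ = Gm B := by
  simp [Gm, Matrix.transpose_mul]

lemma Vm_ortho {r m : ℕ} (B : Matrix (Fin m) (Fin r) ℝ) : IsOrthonormalCols (Vm B) := by
  unfold IsOrthonormalCols Vm
  rw [Matrix.transpose_mul, Matrix.mul_assoc, ← Matrix.mul_assoc (Jm B)ᵀ, Jm_transpose_mul,
    ← Matrix.mul_assoc]
  exact (exists_R B).choose_spec.2

lemma Vm_proj {r m : ℕ} (B : Matrix (Fin m) (Fin r) ℝ) : Vm B * (Vm B)ᵀ = Jm B * Gm B * (Jm B)ᵀ := by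
  simp only [Vm, Gm, Matrix.transpose_mul, Matrix.mul_assoc]

lemma Vm_proj_block {r m : ℕ} (B : Matrix (Fin m) (Fin r) ℝ) (i : Fin m) (a : Fin r) :
    (Vm B * (Vm B)ᵀ) (Fin.natAdd r i) (Fin.castAdd m a) = (B * Gm B) i a := by
  rw [Vm_proj]
  simp only [Matrix.mul_apply, Matrix.transpose_apply, Jm_castAdd, Jm_natAdd, Matrix.one_apply]
  simp

lemma one_sub_Gm {r m : ℕ} (B : Matrix (Fin m) (Fin r) ℝ) : 1 - Gm B = Bᵀ * B * Gm B := by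
  have := mul_Gm B
  rw [Matrix.add_mul, Matrix.one_mul] at this
  rw [← this]; abel

lemma one_sub_Gm' {r m : ℕ} (B : Matrix (Fin m) (Fin r) ℝ) :
    1 - Gm B = (B * Gm B)ᵀ * (B * Gm B) + (Bᵀ * B * Gm B)ᵀ * (Bᵀ * B * Gm B) := by
  simp only [Matrix.transpose_mul, Matrix.transpose_transpose, Gm_transpose]
  have h : Gm B * (1 + Bᵀ * B) * (Bᵀ * B * Gm B) = 1 - Gm B := by
    rw [Gm_mul, Matrix.one_mul, one_sub_Gm]
  rw [← h, Matrix.mul_add, Matrix.add_mul]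
  simp only [Matrix.mul_one, Matrix.mul_assoc]

lemma bias_bound {r m : ℕ} (B : Matrix (Fin m) (Fin r) ℝ) :
    frobSq (B * Gm B - B) ≤ 1 / 2 * frobSq (Bᵀ * B) := by
  set Y := Bᵀ * B * Gm B with hY
  have h1 : B * Gm B - B = -(B * Y) := by
    rw [hY, ← one_sub_Gm, Matrix.mul_sub, Matrix.mul_one]; abel
  have h2 : Bᵀ * B = Y + Bᵀ * B * Y := by
    have : Bᵀ * B * (1 + Bᵀ * B) * Gm B = Bᵀ * B := by
      rw [Matrix.mul_assoc, mul_Gm, Matrix.mul_one]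
    conv_lhs => rw [← this]
    rw [hY, Matrix.mul_add, Matrix.add_mul, Matrix.mul_one]
    simp only [Matrix.mul_assoc]
  have h3 : frobSq (Bᵀ * B) = frobSq Y + 2 * frobSq (B * Y) + frobSq (Bᵀ * B * Y) := by
    conv_lhs => rw [h2]
    simp only [frobSq_eq_trace, Matrix.transpose_add, Matrix.add_mul, Matrix.mul_add, Matrix.trace_add,
      Matrix.transpose_mul, Matrix.transpose_transpose, Matrix.mul_assoc]
    ring
  have h4 : frobSq (-(B * Y)) = frobSq (B * Y) := by simp [frobSq]
  rw [h1, h4, h3]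
  have := frobSq_nonneg Y
  have := frobSq_nonneg (Bᵀ * B * Y)
  linarith

lemma loss_Vm_le {r m : ℕ} (B C : Matrix (Fin m) (Fin r) ℝ) :
    loss (Vm B) (Vm C) ≤ 2 * frobSq (B - C) := by
  set P := Vm C * (Vm C)ᵀ with hP
  have hPP : P * P = P := proj_idem (Vm_ortho C)
  have hPt : Pᵀ = P := by simp [hP, Matrix.transpose_mul]
  have hq : ∀ A : Matrix (Fin (r + m)) (Fin r) ℝ,
      frobSq ((1 - P) * A) = frobSq A - frobSq ((Vm C)ᵀ * A) := by
    intro A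
    have : (1 - P)ᵀ * (1 - P) = 1 - P := by
      rw [Matrix.transpose_sub, hPt, Matrix.transpose_one, Matrix.mul_sub, Matrix.sub_mul, Matrix.sub_mul,
        hPP]
      simp
    rw [frobSq_eq_trace, Matrix.transpose_mul, Matrix.mul_assoc, ← Matrix.mul_assoc (1 - P)ᵀ, this,
      frobSq_eq_trace, frobSq_eq_trace, Matrix.transpose_mul, Matrix.transpose_transpose, ← Matrix.trace_sub,
      Matrix.sub_mul, Matrix.mul_sub, Matrix.one_mul, hP]
    simp only [Matrix.mul_assoc]
  have h1 : loss (Vm B) (Vm C) = 2 * frobSq ((1 - P) * Vm B) := by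
    rw [loss_eq (Vm_ortho B) (Vm_ortho C), hq, frobSq_eq_trace, frobSq_eq_trace, Vm_ortho B,
      Matrix.transpose_mul, Matrix.transpose_transpose, Matrix.mul_assoc, Matrix.mul_assoc,
      Matrix.trace_mul_comm (Vm B)]
    simp only [Matrix.mul_assoc, Matrix.trace_one, Fintype.card_fin]
    ring
  have h2 : (1 - P) * Jm C = 0 := by
    rw [hP, Vm_proj, Matrix.sub_mul, Matrix.mul_assoc, Jm_transpose_mul, Matrix.mul_assoc, Gm_mul]
    simp
  have h3 : (1 - P) * Vm B = (1 - P) * ((Jm B - Jm C) * Rm B) := by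
    rw [← Matrix.mul_assoc, Matrix.mul_sub, h2, sub_zero, Matrix.mul_assoc]; rfl
  have h4 : frobSq ((Jm B - Jm C) * Rm B) = ((B - C) * Gm B * (B - C)ᵀ).trace := by
    rw [frobSq_eq_trace, Matrix.transpose_mul, Matrix.mul_assoc, ← Matrix.mul_assoc (Jm B - Jm C)ᵀ,
      Jm_sub_transpose_mul, Gm, Matrix.trace_mul_comm, Matrix.mul_assoc, Matrix.mul_assoc,
      Matrix.trace_mul_comm]
  have h5 : frobSq (B - C) = ((B - C) * Gm B * (B - C)ᵀ).trace
      + frobSq (B * Gm B * (B - C)ᵀ) + frobSq (Bᵀ * B * Gm B * (B - C)ᵀ) := by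
    generalize B - C = D
    have e1 : ∀ A : Matrix (Fin m) (Fin r) ℝ, frobSq (A * Dᵀ) = (D * (Aᵀ * A) * Dᵀ).trace := by
      intro A
      rw [frobSq_eq_trace, Matrix.transpose_mul, Matrix.transpose_transpose]
      simp only [Matrix.mul_assoc]
    have e2 : ∀ A : Matrix (Fin r) (Fin r) ℝ, frobSq (A * Dᵀ) = (D * (Aᵀ * A) * Dᵀ).trace := by
      intro A
      rw [frobSq_eq_trace, Matrix.transpose_mul, Matrix.transpose_transpose]
      simp only [Matrix.mul_assoc]
    have e3 : frobSq D = (D * (1 : Matrix (Fin r) (Fin r) ℝ) * Dᵀ).trace := by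
      rw [frobSq_eq_trace, Matrix.mul_one, Matrix.trace_mul_comm]
    rw [e1, e2, e3, ← Matrix.trace_add, ← Matrix.trace_add, ← Matrix.add_mul, ← Matrix.add_mul,
      ← Matrix.mul_add, ← Matrix.mul_add, add_assoc, ← one_sub_Gm', add_sub_cancel]
  rw [h1, h3, hq, h4]
  have := frobSq_nonneg ((Vm C)ᵀ * ((Jm B - Jm C) * Rm B))
  have := frobSq_nonneg (B * Gm B * (B - C)ᵀ)
  have := frobSq_nonneg (Bᵀ * B * Gm B * (B - C)ᵀ)
  linarith

lemma loss_lower {r m : ℕ} (W : Matrix (Fin (r + m)) (Fin r) ℝ) (B : Matrix (Fin m) (Fin r) ℝ) :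
    (∑ i, ∑ a, ((W * Wᵀ) (Fin.natAdd r i) (Fin.castAdd m a) - B i a) ^ 2) - frobSq (Bᵀ * B)
      ≤ loss W (Vm B) := by
  have h1 : 2 * ∑ i : Fin m, ∑ a : Fin r,
      ((W * Wᵀ) (Fin.natAdd r i) (Fin.castAdd m a) - (B * Gm B) i a) ^ 2 ≤ loss W (Vm B) := by
    unfold loss frobSq
    set D := W * Wᵀ - Vm B * (Vm B)ᵀ with hD
    have hsym : ∀ i j, D i j = D j i := by
      intro i j
      have : Dᵀ = D := by simp [hD, Matrix.transpose_mul]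
      conv_lhs => rw [← this]
      rfl
    have hb : ∀ i a, (W * Wᵀ) (Fin.natAdd r i) (Fin.castAdd m a) - (B * Gm B) i a
      = D (Fin.natAdd r i) (Fin.castAdd m a) := by
      intro i a
      rw [hD, Matrix.sub_apply, Vm_proj_block]
    simp_rw [hb, Fin.sum_univ_add, Finset.sum_add_distrib]
    have e : ∑ a : Fin r, ∑ i : Fin m, D (Fin.castAdd m a) (Fin.natAdd r i) ^ 2
       = ∑ i : Fin m, ∑ a : Fin r, D (Fin.natAdd r i) (Fin.castAdd m a) ^ 2 := by
      rw [Finset.sum_comm]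
      simp_rw [hsym (Fin.castAdd m _)]
    rw [e]
    have p1 : 0 ≤ ∑ a : Fin r, ∑ i : Fin r, D (Fin.castAdd m a) (Fin.castAdd m i) ^ 2 := by positivity
    have p2 : 0 ≤ ∑ a : Fin m, ∑ i : Fin m, D (Fin.natAdd r a) (Fin.natAdd r i) ^ 2 := by positivity
    linarith
  have h2 : ∑ i, ∑ a, ((W * Wᵀ) (Fin.natAdd r i) (Fin.castAdd m a) - B i a) ^ 2
      ≤ 2 * ∑ i : Fin m, ∑ a : Fin r,
      ((W * Wᵀ) (Fin.natAdd r i) (Fin.castAdd m a) - (B * Gm B) i a) ^ 2 + 2 * frobSq (B * Gm B - B) := by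
    unfold frobSq
    simp_rw [Finset.mul_sum]
    rw [← Finset.sum_add_distrib]
    refine Finset.sum_le_sum fun i _ => ?_
    rw [← Finset.sum_add_distrib]
    refine Finset.sum_le_sum fun a _ => ?_
    rw [Matrix.sub_apply]
    nlinarith [sq_nonneg (((W * Wᵀ) (Fin.natAdd r i) (Fin.castAdd m a) - (B * Gm B) i a)
      - ((B * Gm B) i a - B i a))]
  have := bias_bound B
  linarith

/-! ### Hypercube averaging -/

/-- Sign of a boolean. -/
def sg (b : Bool) : ℝ := if b then 1 else -1

lemma sg_sq (b : Bool) : sg b * sg b = 1 := by cases b <;> simp [sg]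

lemma sg_not (b : Bool) : sg (!b) = - sg b := by cases b <;> simp [sg]

/-- Flip one coordinate. -/
def flip1 {ι : Type*} [DecidableEq ι] (p : ι) (θ : ι → Bool) : ι → Bool :=
  Function.update θ p (!θ p)

lemma flip1_same {ι : Type*} [DecidableEq ι] (p : ι) (θ : ι → Bool) : flip1 p θ p = !θ p := by
  simp [flip1]

lemma flip1_ne {ι : Type*} [DecidableEq ι] (p q : ι) (h : q ≠ p) (θ : ι → Bool) :
    flip1 p θ q = θ q := by
  simp [flip1, h]

lemma flip1_invol {ι : Type*} [DecidableEq ι] (p : ι) : Function.Involutive (flip1 p) := by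
  intro θ
  funext q
  by_cases h : q = p
  · subst h; simp [flip1_same]
  · simp [flip1_ne _ _ h]

lemma sum_flip1 {ι : Type*} [DecidableEq ι] [Fintype ι] (p : ι) (F : (ι → Bool) → ℝ) :
    ∑ θ, F (flip1 p θ) = ∑ θ, F θ :=
  Equiv.sum_comp (flip1_invol p).toPerm F

/-- The hypercube parameter. -/
def Bc {m r : ℕ} (ε : ℝ) (θ : Fin m × Fin r → Bool) : Matrix (Fin m) (Fin r) ℝ :=
  Matrix.of fun i a => ε * sg (θ (i, a))

lemma frob_flip {m r : ℕ} (ε : ℝ) (θ : Fin m × Fin r → Bool) (p : Fin m × Fin r) :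
    frobSq (Bc ε θ - Bc ε (flip1 p θ)) = 4 * ε ^ 2 := by
  unfold frobSq
  rw [← Fintype.sum_prod_type' (f := fun i a => (Bc ε θ - Bc ε (flip1 p θ)) i a ^ 2)]
  rw [Finset.sum_eq_single p]
  · have h := sg_sq (θ p)
    simp only [Matrix.sub_apply, Bc, Matrix.of_apply, Prod.mk.eta, flip1_same, sg_not]
    linear_combination 4 * ε ^ 2 * h
  · intro q _ hq
    simp only [Matrix.sub_apply, Bc, Matrix.of_apply, Prod.mk.eta, flip1_ne _ _ hq]
    simp
  · simp

lemma sum_offdiag {m r : ℕ} (a b : Fin r) :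
    ∑ θ : Fin m × Fin r → Bool, (∑ i, sg (θ (i, a)) * sg (θ (i, b))) ^ 2
      ≤ (Fintype.card (Fin m × Fin r → Bool) : ℝ) * (m + if a = b then (m : ℝ) ^ 2 else 0) := by
  by_cases hab : a = b
  · subst hab
    simp only [sg_sq, if_true]
    simp only [Finset.sum_const, Finset.card_univ, nsmul_eq_mul, Fintype.card_fin, mul_one]
    gcongr
    have : (0 : ℝ) ≤ m := by positivity
    linarith
  · simp only [hab, if_false, add_zero]
    apply le_of_eq
    simp_rw [sq, Finset.sum_mul_sum]
    rw [Finset.sum_comm]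
    have key : ∀ i : Fin m, ∑ θ : Fin m × Fin r → Bool, ∑ j : Fin m,
        sg (θ (i, a)) * sg (θ (i, b)) * (sg (θ (j, a)) * sg (θ (j, b)))
        = (Fintype.card (Fin m × Fin r → Bool) : ℝ) := by
      intro i
      rw [Finset.sum_comm, Finset.sum_eq_single i]
      · have : ∀ θ : Fin m × Fin r → Bool,
          sg (θ (i, a)) * sg (θ (i, b)) * (sg (θ (i, a)) * sg (θ (i, b))) = 1 := by
          intro θ
          have h1 := sg_sq (θ (i, a))
          have h2 := sg_sq (θ (i, b))
          calc _ = (sg (θ (i, a)) * sg (θ (i, a))) * (sg (θ (i, b)) * sg (θ (i, b))) := by ring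
            _ = 1 := by rw [h1, h2]; norm_num
        simp [this]
      · intro j _ hj
        have h := sum_flip1 (i, a) fun θ : Fin m × Fin r → Bool =>
          sg (θ (i, a)) * sg (θ (i, b)) * (sg (θ (j, a)) * sg (θ (j, b)))
        have n1 : (i, b) ≠ (i, a) := by simp [Ne.symm hab]
        have n2 : (j, a) ≠ (i, a) := by simp [hj]
        have n3 : (j, b) ≠ (i, a) := by simp [hj]
        simp only [flip1_same, flip1_ne _ _ n1, flip1_ne _ _ n2, flip1_ne _ _ n3, sg_not, neg_mul,
          Finset.sum_neg_distrib] at h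
        linarith
      · simp
    rw [Finset.sum_congr rfl fun i _ => key i]
    simp [mul_comm]

lemma sum_frob {m r : ℕ} (ε : ℝ) :
    ∑ θ : Fin m × Fin r → Bool, frobSq ((Bc ε θ)ᵀ * Bc ε θ)
      ≤ (Fintype.card (Fin m × Fin r → Bool) : ℝ) * (ε ^ 4 * (r * m * (m + r))) := by
  have h1 : ∀ θ : Fin m × Fin r → Bool, frobSq ((Bc ε θ)ᵀ * Bc ε θ)
      = ε ^ 4 * ∑ a, ∑ b, (∑ i, sg (θ (i, a)) * sg (θ (i, b))) ^ 2 := by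
    intro θ
    unfold frobSq
    simp_rw [Finset.mul_sum (s := Finset.univ (α := Fin r))]
    refine Finset.sum_congr rfl fun a _ => Finset.sum_congr rfl fun b _ => ?_
    have : ((Bc ε θ)ᵀ * Bc ε θ) a b = ε ^ 2 * ∑ i, sg (θ (i, a)) * sg (θ (i, b)) := by
      simp only [Matrix.mul_apply, Matrix.transpose_apply, Bc, Matrix.of_apply, Finset.mul_sum]
      exact Finset.sum_congr rfl fun i _ => by ring
    rw [this]; ring
  simp_rw [h1]
  rw [← Finset.mul_sum, Finset.sum_comm]
  have h2 : ∑ a : Fin r, ∑ θ : Fin m × Fin r → Bool, ∑ b : Fin r,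
      (∑ i, sg (θ (i, a)) * sg (θ (i, b))) ^ 2
      ≤ ∑ a : Fin r, ∑ b : Fin r,
        (Fintype.card (Fin m × Fin r → Bool) : ℝ) * (m + if a = b then (m : ℝ) ^ 2 else 0) := by
    refine Finset.sum_le_sum fun a _ => ?_
    rw [Finset.sum_comm]
    exact Finset.sum_le_sum fun b _ => sum_offdiag a b
  have h3 : ∑ a : Fin r, ∑ b : Fin r,
        (Fintype.card (Fin m × Fin r → Bool) : ℝ) * (m + if a = b then (m : ℝ) ^ 2 else 0)
      = (Fintype.card (Fin m × Fin r → Bool) : ℝ) * (r * m * (m + r)) := by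
    simp_rw [← Finset.mul_sum, Finset.sum_add_distrib]
    congr 1
    simp
    ring
  calc _ ≤ ε ^ 4 * ((Fintype.card (Fin m × Fin r → Bool) : ℝ) * (r * m * (m + r))) := by
        rw [← h3]; gcongr
    _ = _ := by ring

lemma coord_bound {m r : ℕ} (n : ℕ) {lam : ℝ} (hl : 0 < lam) (ε : ℝ)
    (hε : n * hfun lam * ε ^ 2 ≤ 1 / 3) (g : (Fin n → Fin (r + m) → ℝ) → ℝ) (hg : Measurable g)
    (hgb : ∀ x, |g x| ≤ 1) (p : Fin m × Fin r) :
    (Fintype.card (Fin m × Fin r → Bool) : ℝ) * (ε ^ 2 / 4) ≤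
      ∑ θ : Fin m × Fin r → Bool, ∫ x, (g x - Bc ε θ p.1 p.2) ^ 2
        ∂(spikedMeasure n (r + m) r (fun _ => lam) (Vm (Bc ε θ)) 1) := by
  set F : (Fin m × Fin r → Bool) → ℝ := fun θ => ∫ x, (g x - Bc ε θ p.1 p.2) ^ 2
        ∂(spikedMeasure n (r + m) r (fun _ => lam) (Vm (Bc ε θ)) 1) with hF
  have hfl := sum_flip1 p F
  have hint : ∀ θ : Fin m × Fin r → Bool, ∀ t : ℝ, Integrable (fun x => (g x - t) ^ 2)
      (spikedMeasure n (r + m) r (fun _ => lam) (Vm (Bc ε θ)) 1) := by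
    intro θ t
    have : IsProbabilityMeasure (spikedMeasure n (r + m) r (fun _ => lam) (Vm (Bc ε θ)) 1) :=
      inferInstance
    refine Integrable.of_bound ((hg.sub_const t).pow_const 2).aestronglyMeasurable ((1 + |t|) ^ 2)
      (Filter.Eventually.of_forall fun x => ?_)
    rw [norm_pow]
    gcongr
    exact (norm_sub_le _ _).trans (by simpa using hgb x)
  have hpt : ∀ θ, ε ^ 2 / 2 ≤ F θ + F (flip1 p θ) := by
    intro θ
    have h := two_point n hl (Vm_ortho (Bc ε θ)) (Vm_ortho (Bc ε (flip1 p θ)))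
      (fun x => (g x - Bc ε θ p.1 p.2) ^ 2) (fun x => (g x - Bc ε (flip1 p θ) p.1 p.2) ^ 2)
      (fun x => sq_nonneg _) (fun x => sq_nonneg _) (2 * ε ^ 2) (by positivity) (fun x => by
        have h := sg_sq (θ p)
        simp only [Bc, Matrix.of_apply, Prod.mk.eta, flip1_same, sg_not]
        have : (g x - ε * sg (θ p)) ^ 2 + (g x - ε * -sg (θ p)) ^ 2 = 2 * g x ^ 2 + 2 * ε ^ 2 := by
          linear_combination 2 * ε ^ 2 * h
        rw [this]
        nlinarith [sq_nonneg (g x)]) (hint _ _) (hint _ _)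
    refine le_trans ?_ h
    have hL := loss_Vm_le (Bc ε θ) (Bc ε (flip1 p θ))
    rw [frob_flip] at hL
    have hh : 0 ≤ n * hfun lam / 4 := by
      unfold hfun; positivity
    have h6 : n * hfun lam / 4 * loss (Vm (Bc ε θ)) (Vm (Bc ε (flip1 p θ))) ≤ 2 / 3 := by
      calc _ ≤ n * hfun lam / 4 * (2 * (4 * ε ^ 2)) := by gcongr
        _ = 2 * (n * hfun lam * ε ^ 2) := by ring
        _ ≤ 2 / 3 := by linarith
    have h7 : (1 : ℝ) / 4 ≤ 1 / 2 - 3 / 8 * (n * hfun lam / 4 * loss (Vm (Bc ε θ)) (Vm (Bc ε (flip1 p θ)))) := by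
      linarith
    calc ε ^ 2 / 2 = 2 * ε ^ 2 * (1 / 4) := by ring
      _ ≤ _ := by gcongr
  have hs := Finset.sum_le_sum fun θ (_ : θ ∈ (Finset.univ : Finset (Fin m × Fin r → Bool))) => hpt θ
  rw [Finset.sum_add_distrib, hfl, Finset.sum_const, Finset.card_univ, nsmul_eq_mul] at hs
  linarith

lemma entry_le {k r : ℕ} {W : Matrix (Fin k) (Fin r) ℝ} (hW : IsOrthonormalCols W) (i j : Fin k) :
    |(W * Wᵀ) i j| ≤ 1 := by
  have hPP : (W * Wᵀ) * (W * Wᵀ) = W * Wᵀ := proj_idem hW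
  set P := W * Wᵀ with hP
  have hs : ∀ i j, P i j = P j i := by
    intro i j
    have : Pᵀ = P := by simp [hP, Matrix.transpose_mul]
    conv_lhs => rw [← this]
    rfl
  have h1 : ∀ i, P i i = ∑ j, P i j ^ 2 := by
    intro i
    conv_lhs => rw [← hPP]
    rw [Matrix.mul_apply]
    exact Finset.sum_congr rfl fun j _ => by rw [hs j i, sq]
  have h2 : ∀ j, P i j ^ 2 ≤ P i i := by
    intro j
    rw [h1]
    exact Finset.single_le_sum (f := fun j => P i j ^ 2) (fun _ _ => sq_nonneg _) (Finset.mem_univ j)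
  have h3 : P i i ≤ 1 := by
    by_contra h
    have := h2 i
    nlinarith
  rw [← sq_le_one_iff_abs_le_one]
  exact (h2 j).trans h3

lemma loss_le {k r : ℕ} {V W : Matrix (Fin k) (Fin r) ℝ} (hV : IsOrthonormalCols V)
    (hW : IsOrthonormalCols W) : loss V W ≤ 2 * r := by
  rw [loss_eq hV hW]
  have : ((V * Vᵀ) * (W * Wᵀ)).trace = frobSq (Vᵀ * W) := by
    rw [frobSq_eq_trace, Matrix.transpose_mul, Matrix.transpose_transpose, Matrix.trace_mul_comm]
    rw [Matrix.mul_assoc W, Matrix.trace_mul_comm W]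
    simp only [Matrix.mul_assoc]
  have h := frobSq_nonneg (Vᵀ * W)
  linarith
/-! ### Conclusion -/

lemma continuous_loss {k r : ℕ} (V : Matrix (Fin k) (Fin r) ℝ) :
    Continuous fun W : Fin k → Fin r → ℝ => loss (Matrix.of W) V := by
  unfold loss frobSq
  simp only [Matrix.sub_apply, Matrix.mul_apply, Matrix.transpose_apply, Matrix.of_apply]
  fun_prop

lemma continuous_entry {k r : ℕ} (i j : Fin k) :
    Continuous fun W : Fin k → Fin r → ℝ => (Matrix.of W * (Matrix.of W)ᵀ) i j := by
  simp only [Matrix.mul_apply, Matrix.transpose_apply, Matrix.of_apply]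
  fun_prop

lemma spiked_prob (n k r : ℕ) (Λ : Fin r → ℝ) (V : Matrix (Fin k) (Fin r) ℝ) :
    IsProbabilityMeasure (spikedMeasure n k r Λ V 1) := by
  unfold spikedMeasure
  refine Measure.isProbabilityMeasure_map (Continuous.aemeasurable ?_)
  fun_prop

lemma loss_nonneg {k r : ℕ} (V W : Matrix (Fin k) (Fin r) ℝ) : 0 ≤ loss V W := frobSq_nonneg _

lemma loss_integrable {n k r : ℕ} (Λ : Fin r → ℝ) {V : Matrix (Fin k) (Fin r) ℝ}
    (hV : IsOrthonormalCols V) (V₀ : Matrix (Fin k) (Fin r) ℝ) {f : (Fin n → Fin k → ℝ) → (Fin k → Fin r → ℝ)}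
    (hf : Measurable f) (hfo : ∀ x, IsOrthonormalCols (Matrix.of (f x))) :
    Integrable (fun x => loss (Matrix.of (f x)) V) (spikedMeasure n k r Λ V₀ 1) := by
  have := spiked_prob n k r Λ V₀
  refine Integrable.of_bound ((continuous_loss V).measurable.comp hf).aestronglyMeasurable (2 * r)
    (Filter.Eventually.of_forall fun x => ?_)
  rw [Real.norm_eq_abs, abs_of_nonneg (loss_nonneg _ _)]
  exact loss_le (hfo x) hV

lemma risk_le {n k r : ℕ} (Λ : Fin r → ℝ) {V : Matrix (Fin k) (Fin r) ℝ}
    (hV : IsOrthonormalCols V) {f : (Fin n → Fin k → ℝ) → (Fin k → Fin r → ℝ)}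
    (hf : Measurable f) (hfo : ∀ x, IsOrthonormalCols (Matrix.of (f x))) :
    ∫ x, loss (Matrix.of (f x)) V ∂(spikedMeasure n k r Λ V 1) ≤ 2 * r := by
  have := spiked_prob n k r Λ V
  calc _ ≤ ∫ x, (2 * r : ℝ) ∂(spikedMeasure n k r Λ V 1) :=
        integral_mono (loss_integrable Λ hV V hf hfo) (integrable_const _) fun x => loss_le (hfo x) hV
    _ = 2 * r := by simp

lemma avg_bound {m r : ℕ} (n : ℕ) {lam : ℝ} (hl : 0 < lam) (ε : ℝ)
    (hε : n * hfun lam * ε ^ 2 ≤ 1 / 3) (hε2 : ε ^ 2 * (m + r) ≤ 1 / 8)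
    {f : (Fin n → Fin (r + m) → ℝ) → (Fin (r + m) → Fin r → ℝ)}
    (hf : Measurable f) (hfo : ∀ x, IsOrthonormalCols (Matrix.of (f x))) :
    ∃ B : Matrix (Fin m) (Fin r) ℝ, r * m * ε ^ 2 / 8 ≤
      ∫ x, loss (Matrix.of (f x)) (Vm B) ∂(spikedMeasure n (r + m) r (fun _ => lam) (Vm B) 1) := by
  set M : (Fin n → Fin (r + m) → ℝ) → Fin m → Fin r → ℝ := fun x i a =>
    (Matrix.of (f x) * (Matrix.of (f x))ᵀ) (Fin.natAdd r i) (Fin.castAdd m a) with hM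
  have hMm : ∀ i a, Measurable fun x => M x i a := fun i a =>
    (continuous_entry _ _).measurable.comp hf
  have hMb : ∀ i a x, |M x i a| ≤ 1 := fun i a x => entry_le (hfo x) _ _
  set N : ℝ := (Fintype.card (Fin m × Fin r → Bool) : ℝ) with hN
  have hNpos : 0 < N := by rw [hN]; exact_mod_cast Fintype.card_pos
  have hint : ∀ (B : Matrix (Fin m) (Fin r) ℝ) i a, Integrable (fun x => (M x i a - B i a) ^ 2)
      (spikedMeasure n (r + m) r (fun _ => lam) (Vm B) 1) := by
    intro B i a
    have := spiked_prob n (r + m) r (fun _ => lam) (Vm B)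
    refine Integrable.of_bound (((hMm i a).sub_const _).pow_const 2).aestronglyMeasurable
      ((1 + |B i a|) ^ 2) (Filter.Eventually.of_forall fun x => ?_)
    rw [norm_pow]
    gcongr
    exact (norm_sub_le _ _).trans (by simpa using hMb i a x)
  have hlow : ∀ B : Matrix (Fin m) (Fin r) ℝ,
      (∑ i, ∑ a, ∫ x, (M x i a - B i a) ^ 2 ∂(spikedMeasure n (r + m) r (fun _ => lam) (Vm B) 1))
        - frobSq (Bᵀ * B) ≤
      ∫ x, loss (Matrix.of (f x)) (Vm B) ∂(spikedMeasure n (r + m) r (fun _ => lam) (Vm B) 1) := by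
    intro B
    have := spiked_prob n (r + m) r (fun _ => lam) (Vm B)
    have hi1 : Integrable (fun x => ∑ i, ∑ a, (M x i a - B i a) ^ 2)
        (spikedMeasure n (r + m) r (fun _ => lam) (Vm B) 1) :=
      integrable_finset_sum _ fun i _ => integrable_finset_sum _ fun a _ => hint B i a
    have e : (∑ i, ∑ a, ∫ x, (M x i a - B i a) ^ 2
        ∂(spikedMeasure n (r + m) r (fun _ => lam) (Vm B) 1)) - frobSq (Bᵀ * B)
        = ∫ x, ((∑ i, ∑ a, (M x i a - B i a) ^ 2) - frobSq (Bᵀ * B))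
          ∂(spikedMeasure n (r + m) r (fun _ => lam) (Vm B) 1) := by
      rw [integral_sub hi1 (integrable_const _),
        integral_finset_sum _ fun i _ => integrable_finset_sum _ fun a _ => hint B i a]
      simp_rw [integral_finset_sum Finset.univ fun a _ => hint B _ a]
      simp
    rw [e]
    exact integral_mono (hi1.sub (integrable_const _)) (loss_integrable _ (Vm_ortho B) _ hf hfo)
      fun x => loss_lower _ _
  by_contra hcon
  push Not at hcon
  have h1 : ∑ θ : Fin m × Fin r → Bool,
      ∫ x, loss (Matrix.of (f x)) (Vm (Bc ε θ)) ∂(spikedMeasure n (r + m) r (fun _ => lam) (Vm (Bc ε θ)) 1)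
      < N * (r * m * ε ^ 2 / 8) := by
    calc _ < ∑ θ : Fin m × Fin r → Bool, (r * m * ε ^ 2 / 8 : ℝ) :=
          Finset.sum_lt_sum_of_nonempty Finset.univ_nonempty fun θ _ => hcon _
      _ = _ := by rw [Finset.sum_const, Finset.card_univ, nsmul_eq_mul]
  have h2 := Finset.sum_le_sum fun θ (_ : θ ∈ (Finset.univ : Finset (Fin m × Fin r → Bool))) =>
    hlow (Bc ε θ)
  rw [Finset.sum_sub_distrib] at h2
  have h3 : N * (r * m * ε ^ 2 / 4) ≤ ∑ θ : Fin m × Fin r → Bool, ∑ i, ∑ a,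
      ∫ x, (M x i a - Bc ε θ i a) ^ 2 ∂(spikedMeasure n (r + m) r (fun _ => lam) (Vm (Bc ε θ)) 1) := by
    rw [Finset.sum_comm]
    have : ∀ i : Fin m, ∑ a : Fin r, N * (ε ^ 2 / 4) ≤ ∑ θ : Fin m × Fin r → Bool, ∑ a,
      ∫ x, (M x i a - Bc ε θ i a) ^ 2 ∂(spikedMeasure n (r + m) r (fun _ => lam) (Vm (Bc ε θ)) 1) := by
      intro i
      rw [Finset.sum_comm]
      exact Finset.sum_le_sum fun a _ =>
        coord_bound n hl ε hε (fun x => M x i a) (hMm i a) (hMb i a) (i, a)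
    refine le_trans (le_of_eq ?_) (Finset.sum_le_sum fun i _ => this i)
    simp
    ring
  have h4 := sum_frob (m := m) (r := r) ε
  rw [← hN] at h4
  have h5 : ε ^ 4 * (r * m * (m + r)) ≤ r * m * ε ^ 2 / 8 := by
    calc ε ^ 4 * (r * m * (m + r)) = (r * m * ε ^ 2) * (ε ^ 2 * (m + r)) := by ring
      _ ≤ (r * m * ε ^ 2) * (1 / 8) := by gcongr
      _ = _ := by ring
  have h6 := mul_le_mul_of_nonneg_left h5 hNpos.le
  linarith

lemma weakLq_zero_le {k r : ℕ} (V : Matrix (Fin k) (Fin r) ℝ) : weakLq 0 V ≤ k := by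
  unfold weakLq
  refine Real.iSup_le (fun j => ?_) (by positivity)
  have hj : ((j : ℕ) + 1 : ℝ) ≤ k := by exact_mod_cast j.2
  split_ifs
  · simp
  · simpa using hj

lemma minimax_ge {n k r : ℕ} {lam κ c : ℝ} (hl : 0 < lam) (hκ : 1 < κ) (V₀ : Matrix (Fin k) (Fin r) ℝ)
    (hV₀ : IsOrthonormalCols V₀)
    (h : ∀ f : (Fin n → Fin k → ℝ) → (Fin k → Fin r → ℝ), Measurable f →
      (∀ x, IsOrthonormalCols (Matrix.of (f x))) →
      ∃ V : Matrix (Fin k) (Fin r) ℝ, IsOrthonormalCols V ∧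
        c ≤ ∫ x, loss (Matrix.of (f x)) V ∂(spikedMeasure n k r (fun _ => lam) V 1)) :
    c ≤ minimaxRisk 0 n k r k lam κ := by
  unfold minimaxRisk
  have : Nonempty {f : (Fin n → Fin k → ℝ) → (Fin k → Fin r → ℝ) //
      Measurable f ∧ ∀ x, IsOrthonormalCols (Matrix.of (f x))} :=
    ⟨⟨fun _ => V₀, measurable_const, fun _ => hV₀⟩⟩
  refine le_ciInf fun est => ?_
  obtain ⟨f, hf, hfo⟩ := est
  obtain ⟨V, hV, hc⟩ := h f hf hfo
  have hT : InTheta 0 k k r lam κ V (fun _ => lam) :=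
    ⟨hV, weakLq_zero_le V, antitone_const, fun _ => ⟨hl, le_rfl, by nlinarith⟩⟩
  have hb : ∀ (V : Matrix (Fin k) (Fin r) ℝ) (Λ : Fin r → ℝ),
      ⨆ (_ : InTheta 0 k k r lam κ V Λ), ∫ x, loss (Matrix.of (f x)) V ∂ spikedMeasure n k r Λ V 1
        ≤ 2 * r := fun V Λ =>
    Real.iSup_le (fun hT => risk_le Λ hT.1 hf hfo) (by positivity)
  refine hc.trans ?_
  refine le_trans ?_ (le_ciSup (f := fun V : Matrix (Fin k) (Fin r) ℝ => ⨆ (Λ : Fin r → ℝ)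
      (_ : InTheta 0 k k r lam κ V Λ), ∫ x, loss (Matrix.of (f x)) V ∂ spikedMeasure n k r Λ V 1)
      ⟨2 * r, by rintro _ ⟨V, rfl⟩; exact Real.iSup_le (fun Λ => hb V Λ) (by positivity)⟩ V)
  refine le_trans ?_ (le_ciSup (f := fun Λ : Fin r → ℝ => ⨆
      (_ : InTheta 0 k k r lam κ V Λ), ∫ x, loss (Matrix.of (f x)) V ∂ spikedMeasure n k r Λ V 1)
      ⟨2 * r, by rintro _ ⟨Λ, rfl⟩; exact hb V Λ⟩ (fun _ => lam))
  exact (ciSup_pos (f := fun _ => ∫ x, loss (Matrix.of (f x)) V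
    ∂ spikedMeasure n k r (fun _ => lam) V 1) hT).ge

lemma minimax_nonneg (n k r : ℕ) (lam κ : ℝ) : 0 ≤ minimaxRisk 0 n k r k lam κ :=
  Real.iInf_nonneg fun _ => Real.iSup_nonneg fun _ => Real.iSup_nonneg fun _ =>
    Real.iSup_nonneg fun _ => integral_nonneg fun _ => loss_nonneg _ _

/-- **Theorem 8** (oracle risk: lower bound for the unstructured
`k`-dimensional PCA problem `Θ₀(k,k,r,λ)`). -/
theorem oracle_lower_bound :
    ∃ c : ℝ, 0 < c ∧
      ∀ (κ : ℝ), 1 < κ →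
        ∀ (n k r : ℕ) (lam : ℝ), 1 ≤ r → r ≤ k → 0 < lam →
          c * min (r : ℝ) (min ((k : ℝ) - r)
                ((r : ℝ) * ((k : ℝ) - r) / ((n : ℝ) * hfun lam)))
            ≤ minimaxRisk 0 n k r k lam κ := by
  refine ⟨1 / 128, by norm_num, ?_⟩
  intro κ hκ n k r lam hr hrk hl
  obtain ⟨m, rfl⟩ := Nat.exists_eq_add_of_le hrk
  have hkm : ((r + m : ℕ) : ℝ) - r = m := by push_cast; ring
  rw [hkm]
  set T := min (r : ℝ) (min (m : ℝ) ((r : ℝ) * m / (n * hfun lam))) with hT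
  have hh : 0 < hfun lam := by unfold hfun; positivity
  rcases Nat.eq_zero_or_pos n with hn | hn
  · have : T ≤ 0 := by
      rw [hT]; refine (min_le_right _ _).trans ((min_le_right _ _).trans ?_)
      simp [hn]
    have := minimax_nonneg n (r + m) r lam κ
    linarith
  rcases Nat.eq_zero_or_pos m with hm | hm
  · have : T ≤ 0 := by
      rw [hT]; refine (min_le_right _ _).trans ((min_le_left _ _).trans ?_)
      simp [hm]
    have := minimax_nonneg n (r + m) r lam κ
    linarith
  have hrR : (0 : ℝ) < r := by exact_mod_cast hr
  have hmR : (0 : ℝ) < m := by exact_mod_cast hm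
  have hnh : (0 : ℝ) < n * hfun lam := mul_pos (by exact_mod_cast hn) hh
  have hTr : T ≤ r := min_le_left _ _
  have hTm : T ≤ m := (min_le_right _ _).trans (min_le_left _ _)
  have hTn : T * (n * hfun lam) ≤ r * m := by
    rw [← le_div_iff₀ hnh]
    exact (min_le_right _ _).trans (min_le_right _ _)
  have hTpos : 0 < T := by rw [hT]; positivity
  have he : (Real.sqrt (T / (16 * (r * m)))) ^ 2 = T / (16 * (r * m)) :=
    Real.sq_sqrt (by positivity)
  refine minimax_ge hl hκ (Vm 0) (Vm_ortho 0) fun f hf hfo => ?_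
  obtain ⟨B, hB⟩ := avg_bound (m := m) (r := r) n hl (Real.sqrt (T / (16 * (r * m))))
    (by
      rw [he, ← mul_div_assoc, div_le_iff₀ (by positivity)]
      nlinarith [mul_pos hrR hmR])
    (by
      rw [he, div_mul_eq_mul_div, div_le_iff₀ (by positivity)]
      nlinarith [mul_le_mul_of_nonneg_right hTr hmR.le, mul_le_mul_of_nonneg_right hTm hrR.le])
    hf hfo
  refine ⟨Vm B, Vm_ortho B, le_trans (le_of_eq ?_) hB⟩
  rw [he]
  field_simp
  norm_num

end SparsePCA
end
end

section
/- Let Σ = I_p + VDV', where V ∈ O(p,r) and D = diag(λ₁,…,λ_r) with λ₁ ≥ ⋯ ≥ λ_r > 0. Then for any T ∈ O(p,r): (λ_r/2)·‖VV' − TT'‖_F² ≤ ⟨Σ, VV' − TT'⟩ ≤ (λ₁/2)·‖VV' − TT'‖_F², where ⟨B,C⟩ = Tr(B'C). -/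
open MeasureTheory ProbabilityTheory Matrix Real
open scoped BigOperators ENNReal NNReal

noncomputable section

namespace SparsePCA

/-- Trace (Frobenius) inner product `⟨B, C⟩ = Tr(Bᵀ C)`. -/
def mInner {m k : Type*} [Fintype m] [Fintype k] (B C : Matrix m k ℝ) : ℝ :=
  (Bᵀ * C).trace

/-- **Lemma 3**: for `Σ = I_p + V D Vᵀ` and any `T ∈ O(p,r)`,
`(λ_r/2) ‖VVᵀ - TTᵀ‖_F² ≤ ⟨Σ, VVᵀ - TTᵀ⟩ ≤ (λ₁/2) ‖VVᵀ - TTᵀ‖_F²`. -/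
theorem spiked_covariance_inner_product_bounds (p r : ℕ) (hr : 0 < r)
    (V T : Matrix (Fin p) (Fin r) ℝ)
    (hV : IsOrthonormalCols V) (hT : IsOrthonormalCols T)
    (Λ : Fin r → ℝ) (hpos : ∀ i, 0 < Λ i) (hanti : Antitone Λ) :
    Λ ⟨r - 1, by omega⟩ / 2 * frobSq (V * Vᵀ - T * Tᵀ)
        ≤ mInner (1 + V * Matrix.diagonal Λ * Vᵀ) (V * Vᵀ - T * Tᵀ) ∧
      mInner (1 + V * Matrix.diagonal Λ * Vᵀ) (V * Vᵀ - T * Tᵀ)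
        ≤ Λ ⟨0, hr⟩ / 2 * frobSq (V * Vᵀ - T * Tᵀ) := by
  unfold IsOrthonormalCols at hV hT
  have hV2 : ∀ X : Matrix (Fin r) (Fin p) ℝ, Vᵀ * (V * X) = X := fun X => by
    rw [← Matrix.mul_assoc, hV, Matrix.one_mul]
  have hT2 : ∀ X : Matrix (Fin r) (Fin p) ℝ, Tᵀ * (T * X) = X := fun X => by
    rw [← Matrix.mul_assoc, hT, Matrix.one_mul]
  have hT3 : ∀ X : Matrix (Fin r) (Fin r) ℝ, Tᵀ * (T * X) = X := fun X => by
    rw [← Matrix.mul_assoc, hT, Matrix.one_mul]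
  obtain ⟨G, hG⟩ : ∃ G, G = 1 - Vᵀ * T * (Tᵀ * V) := ⟨_, rfl⟩
  have hGW : (V - T * (Tᵀ * V))ᵀ * (V - T * (Tᵀ * V)) = G := by
    rw [hG]
    simp only [Matrix.transpose_sub, Matrix.transpose_mul, Matrix.transpose_transpose,
      Matrix.sub_mul, Matrix.mul_sub, Matrix.mul_assoc, hV, hT3]
    abel
  have hc : ∀ i, 0 ≤ G i i := fun i => by
    rw [← hGW, Matrix.mul_apply]
    exact Finset.sum_nonneg fun j _ => by
      rw [Matrix.transpose_apply]; exact mul_self_nonneg _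
  have htrV : (V * Vᵀ).trace = r := by rw [Matrix.trace_mul_comm, hV]; simp
  have htrT : (T * Tᵀ).trace = r := by rw [Matrix.trace_mul_comm, hT]; simp
  have hcross : (V * (Vᵀ * (T * Tᵀ))).trace = (Vᵀ * T * (Tᵀ * V)).trace := by
    rw [Matrix.trace_mul_comm]; simp only [Matrix.mul_assoc]
  have hcross2 : (T * (Tᵀ * (V * Vᵀ))).trace = (Vᵀ * T * (Tᵀ * V)).trace := by
    rw [← Matrix.mul_assoc T, Matrix.trace_mul_comm, Matrix.mul_assoc, hcross]
  have hfrob : frobSq (V * Vᵀ - T * Tᵀ) = 2 * ∑ i, G i i := by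
    have h1 : frobSq (V * Vᵀ - T * Tᵀ)
        = ((V * Vᵀ - T * Tᵀ) * (V * Vᵀ - T * Tᵀ)ᵀ).trace := by
      simp only [frobSq, Matrix.trace, Matrix.diag, Matrix.mul_apply (M := V * Vᵀ - T * Tᵀ),
        Matrix.transpose_apply, sq]
    have h2 : ∑ i, G i i = r - (Vᵀ * T * (Tᵀ * V)).trace := by
      change G.trace = _
      rw [hG, Matrix.trace_sub]; simp
    rw [h1, h2]
    simp only [Matrix.transpose_sub, Matrix.transpose_mul, Matrix.transpose_transpose,
      Matrix.sub_mul, Matrix.mul_sub, Matrix.trace_sub]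
    simp only [Matrix.mul_assoc V, Matrix.mul_assoc T, hV2, hT2]
    rw [htrV, htrT, hcross, hcross2]
    ring
  have hin : mInner (1 + V * Matrix.diagonal Λ * Vᵀ) (V * Vᵀ - T * Tᵀ)
      = ∑ i, Λ i * G i i := by
    have h3 : (V * (Matrix.diagonal Λ * (Vᵀ * (V * Vᵀ - T * Tᵀ)))).trace
        = (Matrix.diagonal Λ * G).trace := by
      rw [Matrix.trace_mul_comm, hG]
      simp only [Matrix.mul_assoc, Matrix.sub_mul, Matrix.mul_sub, hV2, hV, Matrix.mul_one]
    have h4 : (Matrix.diagonal Λ * G).trace = ∑ i, Λ i * G i i := by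
      simp [Matrix.trace, Matrix.diagonal_mul]
    rw [← h4, ← h3, mInner, Matrix.transpose_add, Matrix.add_mul, Matrix.trace_add]
    simp only [Matrix.transpose_one, Matrix.one_mul, Matrix.transpose_mul,
      Matrix.transpose_transpose, Matrix.diagonal_transpose, Matrix.mul_assoc]
    rw [Matrix.trace_sub, htrV, htrT]
    ring
  rw [hfrob, hin]
  constructor
  · rw [div_mul_eq_mul_div, mul_left_comm, mul_div_cancel_left₀ _ (two_ne_zero), Finset.mul_sum]
    refine Finset.sum_le_sum fun i _ => mul_le_mul_of_nonneg_right (hanti ?_) (hc i)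
    rw [Fin.le_def]; have := i.2; simp only; omega
  · rw [div_mul_eq_mul_div, mul_left_comm, mul_div_cancel_left₀ _ (two_ne_zero), Finset.mul_sum]
    refine Finset.sum_le_sum fun i _ => mul_le_mul_of_nonneg_right (hanti ?_) (hc i)
    rw [Fin.le_def]; simp

end SparsePCA
end
end

section
/- Let K ∈ ℝ^{p×p} be a symmetric matrix with Tr(K) = 0 and ‖K‖_F = 1, and let Z be an n×p random matrix with independent standard normal entries. Then for any t > 0: P( (1/√n)·|⟨Z'Z, K⟩| ≥ 2t + 2t²/√n ) ≤ 2·exp(−t²), where ⟨A,B⟩ = Tr(A'B). -/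
open MeasureTheory ProbabilityTheory Matrix Real
open scoped BigOperators ENNReal NNReal

noncomputable section

namespace SparsePCA

lemma scalar_aux {x b : ℝ} (hx : |x| ≤ b) (hb : b < 1) :
    -Real.log (1 - x) ≤ x + x ^ 2 / (2 * (1 - b)) := by
  have h1 := abs_le.mp hx
  rcases le_or_gt 0 x with h0 | h0
  · have hu : 0 < 1 - x := by linarith
    have hl : 0 ≤ Real.log (1 - x)⁻¹ := Real.log_nonneg (by
      rw [one_le_inv₀ hu]; linarith)
    have h2 := Real.self_le_sinh_iff.mpr hl
    rw [Real.sinh_eq, Real.exp_neg, Real.exp_log (by positivity), Real.log_inv, inv_inv] at h2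
    refine h2.trans ?_
    have h3 : ((1 - x)⁻¹ - (1 - x)) / 2 = x + x ^ 2 / (2 * (1 - x)) := by
      field_simp; ring
    rw [h3]
    gcongr
    linarith
  · have h2 := Real.le_log_one_add_of_nonneg (x := -x) (by linarith)
    have h3 : x ^ 2 / 2 ≤ x ^ 2 / (2 * (1 - b)) := by
      apply div_le_div_of_nonneg_left (by positivity) (by linarith)
      linarith
    have h4 : -x - x ^ 2 / 2 ≤ 2 * (-x) / (-x + 2) := by
      rw [le_div_iff₀ (by linarith)]
      nlinarith [mul_nonneg (sq_nonneg x) (neg_nonneg.mpr h0.le)]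
    have h5 : (1 + -x) = 1 - x := by ring
    rw [h5] at h2
    linarith

lemma sqrt_aux {x b : ℝ} (hx : |x| ≤ b) (hb : b < 1) :
    (Real.sqrt (1 - x))⁻¹ ≤ Real.exp (x / 2 + x ^ 2 / (4 * (1 - b))) := by
  have h1 := abs_le.mp hx
  have hu : 0 < 1 - x := by linarith
  have h := scalar_aux hx hb
  have hs : 0 < Real.sqrt (1 - x) := Real.sqrt_pos.mpr hu
  rw [← Real.log_le_iff_le_exp (by positivity), Real.log_inv, Real.log_sqrt hu.le]
  have : x ^ 2 / (4 * (1 - b)) = (x ^ 2 / (2 * (1 - b))) / 2 := by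
    rw [div_div]; ring_nf
  linarith

lemma gauss_sq_aux (c : ℝ) (x : ℝ) :
    gaussianPDFReal 0 1 x * Real.exp (c * x ^ 2)
      = (Real.sqrt (2 * π))⁻¹ * Real.exp (-(1 / 2 - c) * x ^ 2) := by
  rw [gaussianPDFReal_def, mul_assoc, ← Real.exp_add]
  simp only [NNReal.coe_one, mul_one, sub_zero]
  congr 2
  ring

lemma gauss_sq_integrable {c : ℝ} (hc : c < 1 / 2) :
    Integrable (fun x : ℝ => Real.exp (c * x ^ 2)) (gaussianReal 0 1) := by
  rw [gaussianReal_of_var_ne_zero 0 one_ne_zero]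
  rw [integrable_withDensity_iff_integrable_smul' (measurable_gaussianPDF 0 1)
    (Filter.Eventually.of_forall fun x => gaussianPDF_lt_top)]
  simp only [toReal_gaussianPDF, smul_eq_mul, gauss_sq_aux]
  exact (integrable_exp_neg_mul_sq (by linarith)).const_mul _

lemma gauss_sq_integral {c : ℝ} (hc : c < 1 / 2) :
    ∫ x : ℝ, Real.exp (c * x ^ 2) ∂(gaussianReal 0 1) = (Real.sqrt (1 - 2 * c))⁻¹ := by
  rw [integral_gaussianReal_eq_integral_smul one_ne_zero]
  simp only [smul_eq_mul, gauss_sq_aux]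
  rw [integral_const_mul, integral_gaussian]
  have h1 : 0 < 1 / 2 - c := by linarith
  rw [← Real.sqrt_inv, ← Real.sqrt_mul (by positivity), ← Real.sqrt_inv]
  congr 1
  have : 1 - 2 * c ≠ 0 := by linarith
  have := Real.pi_ne_zero
  field_simp

lemma rot_preserving {p : ℕ} (b : OrthonormalBasis (Fin p) ℝ (EuclideanSpace ℝ (Fin p))) :
    MeasurePreserving (fun x : Fin p → ℝ => WithLp.ofLp (∑ i, x i • b i))
      (stdGaussian (Fin p)) (stdGaussian (Fin p)) := by
  refine ⟨by fun_prop, ?_⟩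
  have h1 := ProbabilityTheory.stdGaussian_eq_map_pi_orthonormalBasis b
  rw [← map_pi_eq_stdGaussian] at h1
  have h2 := congrArg (fun m => Measure.map (WithLp.ofLp) m) h1
  simp only at h2
  rw [Measure.map_map (by fun_prop) (by fun_prop), Measure.map_map (by fun_prop) (by fun_prop)] at h2
  have h3 : (WithLp.ofLp ∘ WithLp.toLp 2 : (Fin p → ℝ) → _) = id := rfl
  rw [h3, Measure.map_id] at h2
  exact h2.symm

lemma quad_rot {p : ℕ} {K : Matrix (Fin p) (Fin p) ℝ} (hK : K.IsHermitian) (x : Fin p → ℝ) :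
    WithLp.ofLp (∑ i, x i • hK.eigenvectorBasis i) ⬝ᵥ
      (K *ᵥ WithLp.ofLp (∑ i, x i • hK.eigenvectorBasis i))
      = ∑ i, hK.eigenvalues i * x i ^ 2 := by
  have hb : ∀ i j, WithLp.ofLp (hK.eigenvectorBasis i) ⬝ᵥ WithLp.ofLp (hK.eigenvectorBasis j)
      = if i = j then 1 else 0 := by
    intro i j
    have := orthonormal_iff_ite.mp hK.eigenvectorBasis.orthonormal j i
    rw [EuclideanSpace.inner_eq_star_dotProduct] at this
    simpa [eq_comm] using this
  simp only [WithLp.ofLp_sum, WithLp.ofLp_smul, Matrix.mulVec_sum, Matrix.mulVec_smul,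
    hK.mulVec_eigenvectorBasis, sum_dotProduct, dotProduct_sum, smul_dotProduct, dotProduct_smul,
    hb, smul_eq_mul]
  simp
  refine Finset.sum_congr rfl fun i _ => ?_
  ring

lemma eig_facts {p : ℕ} {K : Matrix (Fin p) (Fin p) ℝ} (hK : K.IsHermitian)
    (htr : K.trace = 0) (hfrob : frobSq K = 1) :
    ∑ i, hK.eigenvalues i = 0 ∧ ∑ i, hK.eigenvalues i ^ 2 = 1 := by
  constructor
  · have := hK.trace_eq_sum_eigenvalues
    rw [htr] at this
    simpa using this.symm
  · have h1 : (K * K).trace = frobSq K := by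
      simp only [Matrix.trace, Matrix.diag, Matrix.mul_apply, frobSq]
      refine Finset.sum_congr rfl fun i _ => Finset.sum_congr rfl fun j _ => ?_
      have := hK.apply i j
      simp at this
      rw [this]; ring
    rw [← hfrob, ← h1]
    conv_rhs => rw [hK.spectral_theorem, ← map_mul, Unitary.conjStarAlgAut_apply,
      Matrix.trace_mul_cycle]
    simp [Matrix.diagonal_mul_diagonal, Matrix.trace_diagonal, pow_two]

lemma row_mgf {p : ℕ} {K : Matrix (Fin p) (Fin p) ℝ} (hK : K.IsHermitian)
    (htr : K.trace = 0) (hfrob : frobSq K = 1) {s : ℝ} (hs : |s| < 1 / 2) :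
    Integrable (fun z : Fin p → ℝ => Real.exp (s * (z ⬝ᵥ (K *ᵥ z)))) (stdGaussian (Fin p)) ∧
    ∫ z, Real.exp (s * (z ⬝ᵥ (K *ᵥ z))) ∂(stdGaussian (Fin p))
      ≤ Real.exp (s ^ 2 / (1 - 2 * |s|)) := by
  obtain ⟨e1, e2⟩ := eig_facts hK htr hfrob
  have hl : ∀ i, |hK.eigenvalues i| ≤ 1 := by
    intro i
    rw [← sq_le_one_iff_abs_le_one, ← e2]
    exact Finset.single_le_sum (f := fun i => hK.eigenvalues i ^ 2)
      (fun j _ => sq_nonneg _) (Finset.mem_univ i)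
  have hx : ∀ i, |2 * (s * hK.eigenvalues i)| ≤ 2 * |s| := by
    intro i
    rw [abs_mul, abs_mul, abs_two]
    nlinarith [hl i, abs_nonneg s]
  have hc : ∀ i, s * hK.eigenvalues i < 1 / 2 := by
    intro i
    have := (abs_le.mp (hx i)).2
    linarith
  have hmp := rot_preserving hK.eigenvectorBasis
  have hf : AEStronglyMeasurable (fun z : Fin p → ℝ => Real.exp (s * (z ⬝ᵥ (K *ᵥ z))))
      (stdGaussian (Fin p)) := by
    have : Continuous (fun z : Fin p → ℝ => Real.exp (s * (z ⬝ᵥ (K *ᵥ z)))) := by fun_prop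
    exact this.aestronglyMeasurable
  have hcomp : (fun x : Fin p → ℝ => Real.exp (s *
      (WithLp.ofLp (∑ i, x i • hK.eigenvectorBasis i) ⬝ᵥ
      (K *ᵥ WithLp.ofLp (∑ i, x i • hK.eigenvectorBasis i)))))
      = fun x => ∏ i, Real.exp ((s * hK.eigenvalues i) * x i ^ 2) := by
    funext x
    rw [quad_rot, ← Real.exp_sum, Finset.mul_sum]
    congr 1
    exact Finset.sum_congr rfl fun i _ => by ring
  constructor
  · rw [← hmp.integrable_comp hf]
    simp only [Function.comp_def]
    rw [hcomp]
    exact Integrable.fintype_prod (f := fun i (y : ℝ) => Real.exp ((s * hK.eigenvalues i) * y ^ 2))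
      (fun i => gauss_sq_integrable (hc i))
  · rw [← hmp.map_eq, integral_map hmp.aemeasurable (by rw [hmp.map_eq]; exact hf), hcomp,
      stdGaussian,
      integral_fintype_prod_eq_prod (fun i (y : ℝ) => Real.exp ((s * hK.eigenvalues i) * y ^ 2))]
    calc _ ≤ ∏ i, Real.exp ((2 * (s * hK.eigenvalues i)) / 2
          + (2 * (s * hK.eigenvalues i)) ^ 2 / (4 * (1 - 2 * |s|))) := by
          refine Finset.prod_le_prod (fun i _ => integral_nonneg fun _ => (Real.exp_pos _).le)
            fun i _ => ?_
          rw [gauss_sq_integral (hc i)]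
          exact sqrt_aux (hx i) (by linarith)
      _ = _ := by
          rw [← Real.exp_sum]
          congr 1
          have h1 : 1 - 2 * |s| ≠ 0 := by linarith
          have h2 : ∀ i, (2 * (s * hK.eigenvalues i)) / 2
              + (2 * (s * hK.eigenvalues i)) ^ 2 / (4 * (1 - 2 * |s|))
              = s * hK.eigenvalues i + s ^ 2 / (1 - 2 * |s|) * hK.eigenvalues i ^ 2 := by
            intro i
            field_simp
            ring
          simp only [h2]
          rw [Finset.sum_add_distrib, ← Finset.mul_sum, ← Finset.mul_sum, e1, e2]
          ring

lemma mInner_eq {n p : ℕ} (K : Matrix (Fin p) (Fin p) ℝ) (z : Fin n → Fin p → ℝ) :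
    mInner ((Matrix.of z)ᵀ * Matrix.of z) K = ∑ k, z k ⬝ᵥ (K *ᵥ z k) := by
  simp only [mInner, Matrix.trace, Matrix.diag, Matrix.mul_apply, Matrix.transpose_apply,
    Matrix.of_apply, dotProduct, Matrix.mulVec, Finset.sum_mul, Finset.mul_sum]
  have : ∀ i : Fin p, ∑ j : Fin p, ∑ k : Fin n, z k j * z k i * K j i
      = ∑ k : Fin n, ∑ j : Fin p, z k j * z k i * K j i := fun i => Finset.sum_comm
  simp only [this]
  rw [Finset.sum_comm]
  refine Finset.sum_congr rfl fun k _ => ?_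
  rw [Finset.sum_comm]
  refine Finset.sum_congr rfl fun i _ => Finset.sum_congr rfl fun j _ => ?_
  ring

instance stdG_prob (p : ℕ) : IsProbabilityMeasure (stdGaussian (Fin p)) := by
  unfold stdGaussian; infer_instance

instance gM_prob (n p : ℕ) : IsProbabilityMeasure (gaussianMatrix n p) := by
  unfold gaussianMatrix; infer_instance

lemma one_sided (n p : ℕ) (hn : 0 < n)
    (K : Matrix (Fin p) (Fin p) ℝ) (hK : K.IsHermitian) (htr : K.trace = 0)
    (hfrob : frobSq K = 1) (t : ℝ) (ht : 0 < t) :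
    (gaussianMatrix n p).real {z : Fin n → Fin p → ℝ |
        2 * t * Real.sqrt n + 2 * t ^ 2 ≤ ∑ k, z k ⬝ᵥ (K *ᵥ z k)} ≤ Real.exp (-t ^ 2) := by
  set r := Real.sqrt n with hr
  have hrp : 0 < r := Real.sqrt_pos.mpr (by exact_mod_cast hn)
  have hrr : r ^ 2 = n := Real.sq_sqrt (by positivity)
  set s := t / (r + 2 * t) with hsdef
  have hs0 : 0 < s := by positivity
  have hs : |s| < 1 / 2 := by
    rw [abs_of_pos hs0, hsdef, div_lt_div_iff₀ (by positivity) (by norm_num)]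
    linarith
  obtain ⟨hi, hle⟩ := row_mgf hK htr hfrob hs
  rw [abs_of_pos hs0] at hle
  have hexp : (fun z : Fin n → Fin p → ℝ => Real.exp (s * ∑ k, z k ⬝ᵥ (K *ᵥ z k)))
      = fun z => ∏ k, Real.exp (s * (z k ⬝ᵥ (K *ᵥ z k))) := by
    funext z
    rw [Finset.mul_sum, Real.exp_sum]
  have hint : Integrable (fun z : Fin n → Fin p → ℝ =>
      Real.exp (s * ∑ k, z k ⬝ᵥ (K *ᵥ z k))) (gaussianMatrix n p) := by
    rw [hexp]
    exact Integrable.fintype_prod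
      (f := fun (_ : Fin n) (y : Fin p → ℝ) => Real.exp (s * (y ⬝ᵥ (K *ᵥ y)))) (fun _ => hi)
  have hmgf : mgf (fun z : Fin n → Fin p → ℝ => ∑ k, z k ⬝ᵥ (K *ᵥ z k)) (gaussianMatrix n p) s
      ≤ Real.exp (n * (s ^ 2 / (1 - 2 * s))) := by
    unfold mgf
    rw [hexp, gaussianMatrix, integral_fintype_prod_eq_pow
      (fun y : Fin p → ℝ => Real.exp (s * (y ⬝ᵥ (K *ᵥ y)))), Fintype.card_fin, Real.exp_nat_mul]
    exact pow_le_pow_left₀ (integral_nonneg fun _ => (Real.exp_pos _).le) hle n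
  refine (measure_ge_le_exp_mul_mgf _ hs0.le hint).trans ?_
  refine (mul_le_mul_of_nonneg_left hmgf (Real.exp_pos _).le).trans ?_
  rw [← Real.exp_add]
  apply le_of_eq
  congr 1
  have h1 : 1 - 2 * s = r / (r + 2 * t) := by
    rw [hsdef]; field_simp; ring
  rw [h1, ← hrr, hsdef]
  field_simp
  ring

/-- **Lemma 4**: concentration of the Gaussian quadratic form `⟨ZᵀZ, K⟩` for a
symmetric trace-free matrix `K` of unit Frobenius norm. -/
theorem gaussian_quadratic_form_concentration (n p : ℕ)
    (K : Matrix (Fin p) (Fin p) ℝ) (hsymm : Kᵀ = K) (htr : K.trace = 0)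
    (hfrob : frobSq K = 1) (t : ℝ) (ht : 0 < t) :
    (gaussianMatrix n p {z : Fin n → Fin p → ℝ |
        2 * t + 2 * t ^ 2 / Real.sqrt n ≤
          (Real.sqrt n)⁻¹ * |mInner ((Matrix.of z)ᵀ * Matrix.of z) K|}).toReal
      ≤ 2 * Real.exp (-t ^ 2) := by
  rcases Nat.eq_zero_or_pos n with rfl | hn
  · have h0 : {z : Fin 0 → Fin p → ℝ |
        2 * t + 2 * t ^ 2 / Real.sqrt (0 : ℕ) ≤
          (Real.sqrt (0 : ℕ))⁻¹ * |mInner ((Matrix.of z)ᵀ * Matrix.of z) K|} = ∅ := by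
      ext z
      simp [ht]
    rw [h0]
    simp [Real.exp_nonneg]
  have hK : K.IsHermitian := by
    rw [Matrix.IsHermitian, Matrix.conjTranspose_eq_transpose_of_trivial, hsymm]
  have hK' : (-K).IsHermitian := hK.neg
  have htr' : (-K).trace = 0 := by rw [Matrix.trace_neg, htr, neg_zero]
  have hfrob' : frobSq (-K) = 1 := by
    rw [← hfrob]; simp [frobSq]
  have h1 := one_sided n p hn K hK htr hfrob t ht
  have h2 := one_sided n p hn (-K) hK' htr' hfrob' t ht
  have hrp : 0 < Real.sqrt n := Real.sqrt_pos.mpr (by exact_mod_cast hn)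
  change (gaussianMatrix n p).real _ ≤ _
  have h4 := (measureReal_union_le (μ := gaussianMatrix n p) _ _).trans (add_le_add h1 h2)
  rw [← two_mul] at h4
  refine le_trans (measureReal_mono ?_) h4
  intro z hz
  simp only [Set.mem_setOf_eq, mInner_eq] at hz
  have h3 : 2 * t * Real.sqrt n + 2 * t ^ 2 ≤ |∑ k, z k ⬝ᵥ (K *ᵥ z k)| := by
    have := mul_le_mul_of_nonneg_right hz hrp.le
    field_simp at this
    linarith
  rcases le_abs.mp h3 with h | h
  · exact Or.inl h
  · right
    simpa [Matrix.neg_mulVec] using h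

end SparsePCA
end
end

section
/- Let q ∈ [0,2) and 1 ≤ r ≤ p. Then every V ∈ O(p,r) satisfies ((2−q)/2)·r ≤ ‖V‖_{q,w} ≤ r^{q/2}·p^{(2−q)/2}. In particular, the constrained class G_q(s,p) = {V ∈ O(p,r) : ‖V‖_{q,w} ≤ s} is nonempty only if s ≥ ((2−q)/2)·r, and is a proper subset of O(p,r) only if s ≤ r^{q/2}·p^{(2−q)/2}. -/
open MeasureTheory ProbabilityTheory Matrix Real
open scoped BigOperators ENNReal NNReal

noncomputable section

namespace SparsePCA

lemma seq_step (α x y c s : ℝ) (hα : 0 < α) (hα1 : α ≤ 1) (hx : 0 < x) (hy : 0 ≤ y)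
    (hc0 : 0 ≤ c) (hc : c * x ^ (1 - α) ≤ s) (hyx : y ≤ x) :
    α * (c * (x - y)) ≤ s * (x ^ α - y ^ α) := by
  have hB := rpow_one_add_le_one_add_mul_self (s := y / x - 1)
    (by have := div_nonneg hy hx.le; linarith) hα.le hα1
  have e1 : (1 : ℝ) + (y / x - 1) = y / x := by ring
  rw [e1, Real.div_rpow hy hx.le] at hB
  have hxα : 0 < x ^ α := Real.rpow_pos_of_pos hx _
  have hxx : x ^ (1 - α) * x ^ α = x := by
    rw [← Real.rpow_add hx]; simp
  rw [div_le_iff₀ hxα] at hB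
  have hmono : y ^ α ≤ x ^ α := Real.rpow_le_rpow hy hyx hα.le
  have hk : 0 < x ^ (1 - α) := Real.rpow_pos_of_pos hx _
  have h1 : α * (x - y) ≤ x ^ (1 - α) * (x ^ α - y ^ α) := by
    have h2 := mul_le_mul_of_nonneg_left hB hk.le
    have h3 : x ^ (1 - α) * ((1 + α * (y / x - 1)) * x ^ α) = x + α * (y - x) := by
      calc _ = (x ^ (1 - α) * x ^ α) * (1 + α * (y / x - 1)) := by ring
        _ = _ := by rw [hxx]; field_simp
    nlinarith
  calc α * (c * (x - y)) = c * (α * (x - y)) := by ring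
    _ ≤ c * (x ^ (1 - α) * (x ^ α - y ^ α)) := mul_le_mul_of_nonneg_left h1 hc0
    _ = (c * x ^ (1 - α)) * (x ^ α - y ^ α) := by ring
    _ ≤ _ := mul_le_mul_of_nonneg_right hc (by linarith)

lemma seq_sum (α s : ℝ) (hα : 0 < α) (hα1 : α ≤ 1) (b : ℕ → ℝ) (hb0 : ∀ n, 0 ≤ b n)
    (hb : Antitone b) (hs : ∀ n, 0 < b n → ((n : ℝ) + 1) * b n ^ (1 - α) ≤ s) (n : ℕ) :
    α * (∑ j ∈ Finset.range n, b j - n * b n) ≤ s * (b 0 ^ α - b n ^ α) := by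
  induction n with
  | zero => simp
  | succ n ih =>
    have key : α * (((n : ℝ) + 1) * (b n - b (n + 1))) ≤ s * (b n ^ α - b (n + 1) ^ α) := by
      have hle := hb (Nat.le_succ n)
      rcases (hb0 n).eq_or_lt with h | h
      · have h' : b (n + 1) = 0 := le_antisymm (by rw [h]; exact hle) (hb0 _)
        rw [h', ← h]; simp
      · exact seq_step α _ _ _ s hα hα1 h (hb0 _) (by positivity) (hs n h) hle
    rw [Finset.sum_range_succ]
    push_cast
    nlinarith

lemma rowNorm_sq {p r : ℕ} (V : Matrix (Fin p) (Fin r) ℝ) (j : Fin p) :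
    rowNorm V j ^ 2 = (V * Vᵀ) j j := by
  unfold rowNorm
  rw [Real.sq_sqrt (Finset.sum_nonneg fun i _ => sq_nonneg _)]
  simp [Matrix.mul_apply, sq]

lemma rowNorm_sq_le_one {p r : ℕ} (V : Matrix (Fin p) (Fin r) ℝ) (hV : IsOrthonormalCols V)
    (j : Fin p) : rowNorm V j ^ 2 ≤ 1 := by
  rw [rowNorm_sq]
  set P := V * Vᵀ with hP
  have hsymm : Pᵀ = P := by simp [hP]
  have hid : P * P = P := by
    have hV' : Vᵀ * V = 1 := hV
    calc P * P = V * (Vᵀ * V) * Vᵀ := by simp only [hP, Matrix.mul_assoc]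
      _ = P := by rw [hV', Matrix.mul_one]
  have h1 : P j j = ∑ k, P j k ^ 2 := by
    conv_lhs => rw [← hid, Matrix.mul_apply]
    refine Finset.sum_congr rfl fun k _ => ?_
    have : P k j = P j k := by conv_lhs => rw [← hsymm, Matrix.transpose_apply]
    rw [this, sq]
  have h2 : P j j ^ 2 ≤ P j j := by
    conv_rhs => rw [h1]
    exact Finset.single_le_sum (f := fun k => P j k ^ 2) (fun k _ => sq_nonneg _)
      (Finset.mem_univ j)
  nlinarith

lemma sum_rowNorm_sq {p r : ℕ} (V : Matrix (Fin p) (Fin r) ℝ) (hV : IsOrthonormalCols V) :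
    ∑ j, rowNorm V j ^ 2 = r := by
  have hV' : Vᵀ * V = 1 := hV
  calc ∑ j, rowNorm V j ^ 2 = Matrix.trace (V * Vᵀ) := by
        simp only [rowNorm_sq]; rfl
    _ = r := by rw [Matrix.trace_mul_comm, hV']; simp

lemma sum_sorted_sq {p r : ℕ} (V : Matrix (Fin p) (Fin r) ℝ) (hV : IsOrthonormalCols V) :
    ∑ j, sortedRowNorm V j ^ 2 = r := by
  rw [← sum_rowNorm_sq V hV]
  exact Equiv.sum_comp (Tuple.sort (fun i => - rowNorm V i)) (fun j => rowNorm V j ^ 2)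

lemma sorted_nonneg {p r : ℕ} (V : Matrix (Fin p) (Fin r) ℝ) (j : Fin p) :
    0 ≤ sortedRowNorm V j := Real.sqrt_nonneg _

lemma sorted_anti {p r : ℕ} (V : Matrix (Fin p) (Fin r) ℝ) : Antitone (sortedRowNorm V) := by
  intro i j hij
  have := Tuple.monotone_sort (fun i => - rowNorm V i) hij
  simpa [sortedRowNorm] using this

lemma rpow_sq_half (x q : ℝ) (hx : 0 ≤ x) : (x ^ 2) ^ (q / 2) = x ^ q := by
  rw [← Real.rpow_natCast x 2, ← Real.rpow_mul hx]
  congr 1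
  push_cast
  ring

lemma weak_lower (q : ℝ) (hq0 : 0 ≤ q) (hq2 : q < 2) (p r : ℕ) (hr : 1 ≤ r) (hrp : r ≤ p)
    (V : Matrix (Fin p) (Fin r) ℝ) (hV : IsOrthonormalCols V) :
    (2 - q) / 2 * r ≤ weakLq q V := by
  have hp : 0 < p := by omega
  let b : ℕ → ℝ := fun n => if h : n < p then sortedRowNorm V ⟨n, h⟩ ^ 2 else 0
  have hb0 : ∀ n, 0 ≤ b n := by
    intro n; simp only [b]; split_ifs <;> positivity
  have hb : Antitone b := by
    intro m n hmn
    by_cases hn : n < p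
    · have hm : m < p := by omega
      simp only [b, hn, hm, dif_pos]
      exact pow_le_pow_left₀ (sorted_nonneg V _) (sorted_anti V (by simpa using hmn)) 2
    · have : b n = 0 := by simp [b, hn]
      rw [this]; exact hb0 m
  have hbdd : BddAbove (Set.range fun j : Fin p => ((j : ℕ) + 1 : ℝ) *
    (if sortedRowNorm V j = 0 then 0 else (sortedRowNorm V j) ^ q)) := Set.finite_range _ |>.bddAbove
  have hs : ∀ n, 0 < b n → ((n : ℝ) + 1) * b n ^ (1 - (2 - q) / 2) ≤ weakLq q V := by
    intro n hn
    by_cases h : n < p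
    · have hbn : b n = sortedRowNorm V ⟨n, h⟩ ^ 2 := by simp [b, h]
      have hne : sortedRowNorm V ⟨n, h⟩ ≠ 0 := by
        intro h0; rw [hbn, h0] at hn; simp at hn
      have := le_ciSup hbdd ⟨n, h⟩
      simp only [hne, if_false] at this
      rw [hbn, show 1 - (2 - q) / 2 = q / 2 by ring, rpow_sq_half _ _ (sorted_nonneg V _)]
      exact this
    · simp [b, h] at hn
  have hs0 : 0 ≤ weakLq q V := by
    apply Real.iSup_nonneg
    intro j
    have := sorted_nonneg V j
    split_ifs <;> positivity
  have main := seq_sum ((2 - q) / 2) (weakLq q V) (by linarith) (by linarith) b hb0 hb hs p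
  have hbp : b p = 0 := by simp [b]
  have hsum : ∑ j ∈ Finset.range p, b j = r := by
    rw [← sum_sorted_sq V hV, Finset.sum_range]
    refine Finset.sum_congr rfl fun j _ => ?_
    simp [b]
  have hb1 : b 0 ≤ 1 := by
    simp only [b, hp, dif_pos]
    exact rowNorm_sq_le_one V hV _
  rw [hbp, hsum, Real.zero_rpow (by linarith)] at main
  have h1 : b 0 ^ ((2 - q) / 2) ≤ 1 := Real.rpow_le_one (hb0 0) hb1 (by linarith)
  have := mul_le_mul_of_nonneg_left h1 hs0
  simp only [mul_zero, sub_zero, mul_one] at main this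
  exact main.trans this

lemma weak_upper (q : ℝ) (hq0 : 0 ≤ q) (hq2 : q < 2) (p r : ℕ) (hr : 1 ≤ r) (hrp : r ≤ p)
    (V : Matrix (Fin p) (Fin r) ℝ) (hV : IsOrthonormalCols V) :
    weakLq q V ≤ (r : ℝ) ^ (q / 2) * (p : ℝ) ^ ((2 - q) / 2) := by
  have hp : 0 < p := by omega
  have : Nonempty (Fin p) := ⟨⟨0, hp⟩⟩
  apply ciSup_le
  intro j
  split_ifs with h
  · rw [mul_zero]; positivity
  · have h0 := sorted_nonneg V j
    have hj : ((j : ℕ) + 1 : ℝ) * sortedRowNorm V j ^ 2 ≤ r := by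
      rw [← sum_sorted_sq V hV]
      calc ((j : ℕ) + 1 : ℝ) * sortedRowNorm V j ^ 2
          = ∑ i ∈ Finset.Iic j, sortedRowNorm V j ^ 2 := by simp
        _ ≤ ∑ i ∈ Finset.Iic j, sortedRowNorm V i ^ 2 :=
            Finset.sum_le_sum fun i hi =>
              pow_le_pow_left₀ h0 (sorted_anti V (Finset.mem_Iic.mp hi)) 2
        _ ≤ _ := Finset.sum_le_sum_of_subset_of_nonneg (Finset.subset_univ _)
            fun i _ _ => sq_nonneg _
    have hjp : ((j : ℕ) + 1 : ℝ) ≤ p := by exact_mod_cast j.isLt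
    have hpos : (0 : ℝ) < (j : ℕ) + 1 := by positivity
    calc ((j : ℕ) + 1 : ℝ) * sortedRowNorm V j ^ q
        = (((j : ℕ) + 1 : ℝ) * sortedRowNorm V j ^ 2) ^ (q / 2)
            * ((j : ℕ) + 1 : ℝ) ^ ((2 - q) / 2) := by
          rw [Real.mul_rpow hpos.le (by positivity), rpow_sq_half _ _ h0]
          have : ((j : ℕ) + 1 : ℝ) ^ (q / 2) * ((j : ℕ) + 1 : ℝ) ^ ((2 - q) / 2)
              = (j : ℕ) + 1 := by
            rw [← Real.rpow_add hpos, show q / 2 + (2 - q) / 2 = 1 by ring, Real.rpow_one]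
          calc _ = (((j : ℕ) + 1 : ℝ) ^ (q / 2) * ((j : ℕ) + 1 : ℝ) ^ ((2 - q) / 2))
                * sortedRowNorm V j ^ q := by rw [this]
            _ = _ := by ring
      _ ≤ _ := mul_le_mul (Real.rpow_le_rpow (by positivity) hj (by linarith))
          (Real.rpow_le_rpow hpos.le hjp (by linarith)) (by positivity) (by positivity)

/-- **Claim (8)**: for every `V ∈ O(p,r)` one has
`((2-q)/2) r ≤ ‖V‖_{q,w} ≤ r^{q/2} p^{(2-q)/2}`; consequently the class
`G_q(s,p)` is nonempty only if `s ≥ ((2-q)/2) r` and a proper subset of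
`O(p,r)` only if `s ≤ r^{q/2} p^{(2-q)/2}`. -/
theorem weak_lq_radius_range (q : ℝ) (hq0 : 0 ≤ q) (hq2 : q < 2)
    (p r : ℕ) (hr : 1 ≤ r) (hrp : r ≤ p) :
    (∀ V : Matrix (Fin p) (Fin r) ℝ, IsOrthonormalCols V →
        (2 - q) / 2 * r ≤ weakLq q V ∧
          weakLq q V ≤ (r : ℝ) ^ (q / 2) * (p : ℝ) ^ ((2 - q) / 2)) ∧
      (∀ s : ℝ,
        (∃ V : Matrix (Fin p) (Fin r) ℝ, IsOrthonormalCols V ∧ weakLq q V ≤ s) →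
          (2 - q) / 2 * r ≤ s) ∧
      (∀ s : ℝ,
        {V : Matrix (Fin p) (Fin r) ℝ | IsOrthonormalCols V ∧ weakLq q V ≤ s} ⊂
            {V : Matrix (Fin p) (Fin r) ℝ | IsOrthonormalCols V} →
          s ≤ (r : ℝ) ^ (q / 2) * (p : ℝ) ^ ((2 - q) / 2)) := by
  refine ⟨fun V hV => ⟨weak_lower q hq0 hq2 p r hr hrp V hV,
    weak_upper q hq0 hq2 p r hr hrp V hV⟩, ?_, ?_⟩
  · rintro s ⟨V, hV, hs⟩
    exact (weak_lower q hq0 hq2 p r hr hrp V hV).trans hs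
  · intro s hs
    obtain ⟨V, hV, hn⟩ := Set.exists_of_ssubset hs
    have hlt : s < weakLq q V := by
      by_contra hcon
      exact hn ⟨hV, not_lt.mp hcon⟩
    exact hlt.le.trans (weak_upper q hq0 hq2 p r hr hrp V hV)

end SparsePCA
end
end
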